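/- arXiv:1806.03601 — 9 statements merged into one kernel-verified Lean document; each statement's English description precedes it below -/
import Mathlib

section
/- Let A ∈ M(n,ℤ) and let μ be a non-atomic Borel probability measure on the n-torus 𝕋ⁿ = ℝⁿ/ℤⁿ that is invariant and ergodic under the ×A map T_A. Suppose there exist matrices B₁, …, Bₙ ∈ GL(n,ℤ) that are strongly independent over ℤⁿ∖{0}, a Følner sequence Σ = {F_m} in ℕ, and a set E ⊆ ℕ with D_Σ(E) = 1, such that μ is invariant under the ×(Aʲ + Bᵢ) map for every j ∈ E and every i = 1, …, n. Then μ is the Lebesgue (Haar) measure on 𝕋ⁿ. -/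
open MeasureTheory Filter Matrix

noncomputable section

/-- The `n`-torus `ℝⁿ/ℤⁿ`. -/
abbrev Torus (n : ℕ) : Type := Fin n → AddCircle (1 : ℝ)

/-- The `×A` map `T_A : 𝕋ⁿ → 𝕋ⁿ`, `x ↦ A x mod ℤⁿ`. -/
def mulMap {n : ℕ} (A : Matrix (Fin n) (Fin n) ℤ) (x : Torus n) : Torus n :=
  fun i => ∑ j, A i j • x j

/-- The Fourier coefficient `μ̂(k) = ∫ z₁^{k₁} ⋯ zₙ^{kₙ} dμ`. -/
def fourierCoef {n : ℕ} (μ : Measure (Torus n)) (k : Fin n → ℤ) : ℂ :=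
  ∫ x : Torus n, ∏ i, fourier (k i) (x i) ∂μ

/-- A Følner sequence in `ℕ`. -/
def IsFolner (F : ℕ → Finset ℕ) : Prop :=
  ∀ r : ℕ,
    Tendsto (fun m => ((symmDiff ((F m).image (· + r)) (F m)).card : ℝ) / (F m).card)
      atTop (nhds 0)

/-- Matrices `B₁, …, Bₙ` are strongly independent over `ℤⁿ \ {0}` if for every nonzero
row vector `k ∈ ℤⁿ` the row vectors `kB₁, …, kBₙ` are linearly independent over `ℝ`. -/
def StronglyIndependent {n : ℕ} (B : Fin n → Matrix (Fin n) (Fin n) ℤ) : Prop :=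
  ∀ k : Fin n → ℤ, k ≠ 0 →
    LinearIndependent ℝ fun i : Fin n => fun j : Fin n => ((k ᵥ* B i) j : ℝ)

/-- Strong mixing of a map `T` with respect to a measure `μ`. -/
def StronglyMixing {X : Type*} [MeasurableSpace X] (T : X → X) (μ : Measure X) : Prop :=
  ∀ S U : Set X, MeasurableSet S → MeasurableSet U →
    Tendsto (fun j => μ (T^[j] ⁻¹' S ∩ U)) atTop (nhds (μ S * μ U))

/-- The (topological) support of a measure: points all of whose open neighbourhoods have
positive measure; it is the smallest closed set of full measure. -/
def measSupport {X : Type*} [TopologicalSpace X] [MeasurableSpace X] (μ : Measure X) : Set X :=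
  {x | ∀ U : Set X, IsOpen U → x ∈ U → 0 < μ U}

namespace IsFolner

variable {F : ℕ → Finset ℕ}

section Normed

variable {H : Type*} [NormedAddCommGroup H] [NormedSpace ℂ H]

/-- The average of the orbit of `x` under `f` over a finite set `S` of times. -/
def orbitAverage (f : H →L[ℂ] H) (S : Finset ℕ) (x : H) : H :=
  (S.card : ℂ)⁻¹ • ∑ j ∈ S, (f ^ j) x

theorem norm_pow_apply_le {f : H →L[ℂ] H} (hf : ‖f‖ ≤ 1) (j : ℕ) (x : H) :
    ‖(f ^ j) x‖ ≤ ‖x‖ := by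
  induction j with
  | zero => simp
  | succ j ih =>
    rw [pow_succ', mul_apply_eq_comp]
    exact ((f.le_of_opNorm_le hf _).trans_eq (one_mul _)).trans ih

theorem orbitAverage_sub (f : H →L[ℂ] H) (S : Finset ℕ) (x y : H) :
    orbitAverage f S (x - y) = orbitAverage f S x - orbitAverage f S y := by
  simp [orbitAverage, Finset.sum_sub_distrib, smul_sub]

theorem orbitAverage_of_fixed {f : H →L[ℂ] H} {S : Finset ℕ} (hS : S.Nonempty) {x : H}
    (hx : f x = x) : orbitAverage f S x = x := by
  have h (j : ℕ) : (f ^ j) x = x := by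
    induction j with
    | zero => simp
    | succ j ih => rw [pow_succ, mul_apply_eq_comp, hx, ih]
  have hc : (S.card : ℂ) ≠ 0 := by exact_mod_cast hS.card_pos.ne'
  simp only [orbitAverage, h, Finset.sum_const, ← Nat.cast_smul_eq_nsmul ℂ]
  rw [smul_smul, inv_mul_cancel₀ hc, one_smul]

theorem norm_orbitAverage_le {f : H →L[ℂ] H} (hf : ‖f‖ ≤ 1) (S : Finset ℕ) (x : H) :
    ‖orbitAverage f S x‖ ≤ ‖x‖ := by
  rw [orbitAverage, norm_smul, norm_inv, Complex.norm_natCast]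
  rcases S.eq_empty_or_nonempty with rfl | hS
  · simp
  · rw [inv_mul_le_iff₀ (by exact_mod_cast hS.card_pos), ← nsmul_eq_mul]
    exact (norm_sum_le _ _).trans (Finset.sum_le_card_nsmul _ _ _ fun j _ =>
      norm_pow_apply_le hf j x)

theorem norm_orbitAverage_coboundary_le {f : H →L[ℂ] H} (hf : ‖f‖ ≤ 1) (S : Finset ℕ) (x : H) :
    ‖orbitAverage f S (f x - x)‖ ≤
      ((symmDiff (S.image (· + 1)) S).card : ℝ) / S.card * ‖x‖ := by
  have h : ∑ j ∈ S, (f ^ j) (f x - x) =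
      ∑ j ∈ S.image (· + 1) \ S, (f ^ j) x - ∑ j ∈ S \ S.image (· + 1), (f ^ j) x := by
    rw [Finset.sum_sdiff_sub_sum_sdiff, Finset.sum_image (by simp)]
    simp [pow_succ, Finset.sum_sub_distrib]
  have hb (U : Finset ℕ) : ‖∑ j ∈ U, (f ^ j) x‖ ≤ U.card * ‖x‖ := by
    rw [← nsmul_eq_mul]
    exact (norm_sum_le _ _).trans (Finset.sum_le_card_nsmul _ _ _ fun j _ =>
      norm_pow_apply_le hf j x)
  have hc : ((symmDiff (S.image (· + 1)) S).card : ℝ) =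
      (S.image (· + 1) \ S).card + (S \ S.image (· + 1)).card := by
    rw [symmDiff_def, Finset.sup_eq_union, Finset.card_union_of_disjoint disjoint_sdiff_sdiff]
    push_cast; rfl
  rw [orbitAverage, norm_smul, norm_inv, Complex.norm_natCast, h, div_mul_eq_mul_div,
    div_eq_inv_mul, hc, add_mul]
  gcongr
  exact (norm_sub_le _ _).trans (add_le_add (hb _) (hb _))

theorem isClosed_setOf_tendsto_orbitAverage_zero {f : H →L[ℂ] H} (hf : ‖f‖ ≤ 1)
    (F : ℕ → Finset ℕ) :
    IsClosed {x | Tendsto (fun m => orbitAverage f (F m) x) atTop (nhds 0)} := by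
  refine Equicontinuous.isClosed_setOfPred_tendsto (f := fun _ => 0)
    (UniformEquicontinuous.equicontinuous ?_) continuous_const
  refine LipschitzWith.uniformEquicontinuous _ 1 fun m => LipschitzWith.of_dist_le_mul fun x y => ?_
  rw [dist_eq_norm, dist_eq_norm, ← orbitAverage_sub, NNReal.coe_one, one_mul]
  exact norm_orbitAverage_le hf _ _

end Normed

/-- The **mean ergodic theorem** along a Følner sequence: the averages of the orbit of a vector
under a contraction of a Hilbert space converge to a fixed vector. -/
theorem exists_fixed_tendsto_orbitAverage {H : Type*} [NormedAddCommGroup H]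
    [InnerProductSpace ℂ H] [CompleteSpace H] (hF : IsFolner F)
    (hne : ∀ᶠ m in atTop, (F m).Nonempty) {f : H →L[ℂ] H} (hf : ‖f‖ ≤ 1) (x : H) :
    ∃ z, f z = z ∧ Tendsto (fun m => orbitAverage f (F m) x) atTop (nhds z) := by
  let K : Submodule ℂ H := f.eqLocus (1 : H →L[ℂ] H)
  have hKf : ((f - 1 : H →L[ℂ] H).range)ᗮ ≤ K := fun y hy => by
    refine eq_of_norm_le_re_inner_eq_norm_sq (𝕜 := ℂ) ?_ ?_
    · simpa using f.le_of_opNorm_le hf y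
    · have : ∀ w, inner ℂ (f w) y = inner ℂ w y := by
        simpa [Submodule.mem_orthogonal, inner_sub_left, sub_eq_zero] using hy
      exact (congrArg RCLike.re (this y)).trans (inner_self_eq_norm_sq y)
  have hz : Kᗮ ≤ (f - 1 : H →L[ℂ] H).range.topologicalClosure := by
    rw [← Submodule.orthogonal_orthogonal_eq_closure]
    exact Submodule.orthogonal_le hKf
  have hcob : closure (Set.range (f - 1 : H →L[ℂ] H)) ⊆
      {x | Tendsto (fun m => orbitAverage f (F m) x) atTop (nhds 0)} := by
    refine closure_minimal (Set.forall_mem_range.2 fun y => ?_)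
      (isClosed_setOf_tendsto_orbitAverage_zero hf F)
    refine squeeze_zero_norm (fun m => norm_orbitAverage_coboundary_le hf (F m) y) ?_
    simpa using (hF 1).mul_const ‖y‖
  have hPK : f (K.starProjection x) = K.starProjection x := K.starProjection_apply_mem x
  refine ⟨K.starProjection x, hPK, ?_⟩
  have h0 : Tendsto (fun m => orbitAverage f (F m) (x - K.starProjection x)) atTop (nhds 0) :=
    hcob (hz (K.sub_starProjection_mem_orthogonal x))
  have h1 := h0.add_const (K.starProjection x)
  rw [zero_add] at h1
  refine h1.congr' ?_
  filter_upwards [hne] with m hm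
  rw [orbitAverage_sub, orbitAverage_of_fixed hm hPK, sub_add_cancel]

/-- Ergodicity implies decorrelation on average along any Følner sequence. -/
theorem tendsto_average_integral_mul {X : Type*} [MeasurableSpace X] {μ : Measure X}
    [IsProbabilityMeasure μ] {T : X → X} (hT : Ergodic T μ) (hF : IsFolner F)
    (hne : ∀ᶠ m in atTop, (F m).Nonempty) {u v : X → ℂ} (hu : MemLp u 2 μ) (hv : MemLp v 2 μ) :
    Tendsto (fun m => ((F m).card : ℂ)⁻¹ * ∑ j ∈ F m, ∫ x, u (T^[j] x) * v x ∂μ) atTop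
      (nhds ((∫ x, u x ∂μ) * ∫ x, v x ∂μ)) := by
  let U : Lp ℂ 2 μ →L[ℂ] Lp ℂ 2 μ :=
    (Lp.compMeasurePreservingₗᵢ ℂ T hT.toMeasurePreserving).toContinuousLinearMap
  have hU : ‖U‖ ≤ 1 := LinearIsometry.norm_toContinuousLinearMap_le _
  have hUj (j : ℕ) : (U ^ j) (hu.toLp u) =ᵐ[μ] fun x => u (T^[j] x) := by
    have h1 : (U ^ j) (hu.toLp u) =
        Lp.compMeasurePreserving T^[j] (hT.toMeasurePreserving.iterate j) (hu.toLp u) := by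
      rw [← Lp.compMeasurePreserving_iterate, FunLike.coe_pow_eq_iterate]
      rfl
    rw [h1, Lp.toLp_compMeasurePreserving]
    exact MemLp.coeFn_toLp _
  obtain ⟨z, hzU, hz⟩ := hF.exists_fixed_tendsto_orbitAverage hne hU (hu.toLp u)
  obtain ⟨c, hc⟩ : ∃ c, z =ᵐ[μ] Function.const X c := by
    refine hT.ae_eq_const_of_ae_eq_comp_ae (Lp.aestronglyMeasurable z) ?_
    have h1 := Lp.coeFn_compMeasurePreserving z hT.toMeasurePreserving
    have h2 : Lp.compMeasurePreserving T hT.toMeasurePreserving z = z := hzU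
    rw [h2] at h1
    exact h1.symm
  have key {w : X → ℂ} (hw : MemLp w 2 μ) :
      Tendsto (fun m => ((F m).card : ℂ)⁻¹ * ∑ j ∈ F m, ∫ x, u (T^[j] x) * w x ∂μ) atTop
        (nhds (c * ∫ x, w x ∂μ)) := by
    have hin (y : Lp ℂ 2 μ) : inner ℂ (hw.star.toLp (star w)) y = ∫ x, y x * w x ∂μ := by
      rw [L2.inner_def]
      refine integral_congr_ae ?_
      filter_upwards [hw.star.coeFn_toLp] with x hx
      rw [hx]
      simp
    have h1 : Tendsto (fun m => inner ℂ (hw.star.toLp (star w)) (orbitAverage U (F m) (hu.toLp u)))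
        atTop (nhds (inner ℂ (hw.star.toLp (star w)) z)) := tendsto_const_nhds.inner hz
    have h2 : inner ℂ (hw.star.toLp (star w)) z = c * ∫ x, w x ∂μ := by
      rw [hin, ← integral_const_mul]
      refine integral_congr_ae ?_
      filter_upwards [hc] with x hx
      rw [hx, Function.const_apply]
    rw [h2] at h1
    refine h1.congr fun m => ?_
    rw [orbitAverage, inner_smul_right, inner_sum]
    congr 1
    refine Finset.sum_congr rfl fun j _ => ?_
    rw [hin]
    refine integral_congr_ae ?_
    filter_upwards [hUj j] with x hx
    rw [hx]
  have hcu : c = ∫ x, u x ∂μ := by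
    have h1 := key (w := fun _ => 1) (memLp_const 1)
    simp only [mul_one, integral_const, probReal_univ, one_smul] at h1
    refine tendsto_nhds_unique h1 (tendsto_const_nhds.congr' ?_)
    filter_upwards [hne] with m hm
    have hm' : ((F m).card : ℂ) ≠ 0 := by exact_mod_cast hm.card_pos.ne'
    have hj (j : ℕ) : ∫ x, u (T^[j] x) ∂μ = ∫ x, u x ∂μ := by
      have h := hT.toMeasurePreserving.iterate j
      rw [← integral_map (f := u) h.measurable.aemeasurable (by
        rw [h.map_eq]; exact hu.aestronglyMeasurable), h.map_eq]
    simp only [hj, Finset.sum_const, nsmul_eq_mul]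
    rw [inv_mul_cancel_left₀ hm']
  rw [← hcu]
  exact key hv

end IsFolner

theorem eventually_nonempty_of_density_one {F : ℕ → Finset ℕ} {E : Set ℕ} [DecidablePred (· ∈ E)]
    (hE : Tendsto (fun m => (((F m).filter (· ∈ E)).card : ℝ) / (F m).card) atTop (nhds 1)) :
    ∀ᶠ m in atTop, (F m).Nonempty := by
  filter_upwards [hE.eventually_ne one_ne_zero] with m hm
  rw [Finset.nonempty_iff_ne_empty]
  intro h
  simp [h] at hm

/-- A bounded sequence that is constant on a set of density one has that constant as its
average. -/
theorem tendsto_average_of_density_one {F : ℕ → Finset ℕ} {E : Set ℕ} [DecidablePred (· ∈ E)]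
    (hE : Tendsto (fun m => (((F m).filter (· ∈ E)).card : ℝ) / (F m).card) atTop (nhds 1))
    {a : ℕ → ℂ} {c : ℂ} {C : ℝ} (hC : ∀ j, ‖a j - c‖ ≤ C) (hac : ∀ j ∈ E, a j = c) :
    Tendsto (fun m => ((F m).card : ℂ)⁻¹ * ∑ j ∈ F m, a j) atTop (nhds c) := by
  rw [tendsto_iff_norm_sub_tendsto_zero]
  have h0 : Tendsto (fun m => (1 - (((F m).filter (· ∈ E)).card : ℝ) / (F m).card) * C)
      atTop (nhds 0) := by
    simpa using ((tendsto_const_nhds (x := (1 : ℝ))).sub hE).mul_const C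
  refine squeeze_zero' (.of_forall fun _ => norm_nonneg _) ?_ h0
  filter_upwards [eventually_nonempty_of_density_one hE] with m hm
  have hpos : (0 : ℝ) < (F m).card := by exact_mod_cast hm.card_pos
  have hne : ((F m).card : ℂ) ≠ 0 := by exact_mod_cast hm.card_pos.ne'
  have h1 : ((F m).card : ℂ)⁻¹ * ∑ j ∈ F m, a j - c =
      ((F m).card : ℂ)⁻¹ * ∑ j ∈ (F m).filter (· ∉ E), (a j - c) := by
    have h2 : ∑ j ∈ (F m).filter (· ∉ E), (a j - c) = ∑ j ∈ F m, (a j - c) := by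
      refine Finset.sum_filter_of_ne fun j _ hj hjE => hj ?_
      rw [hac j hjE, sub_self]
    rw [h2, Finset.sum_sub_distrib, Finset.sum_const, nsmul_eq_mul, mul_sub,
      inv_mul_cancel_left₀ hne]
  have h3 : (((F m).filter (· ∈ E)).card : ℝ) + ((F m).filter (· ∉ E)).card = (F m).card := by
    exact_mod_cast Finset.card_filter_add_card_filter_not (s := F m) (· ∈ E)
  have h4 : ‖∑ j ∈ (F m).filter (· ∉ E), (a j - c)‖ ≤ ((F m).filter (· ∉ E)).card * C := by
    rw [← nsmul_eq_mul]
    exact (norm_sum_le _ _).trans (Finset.sum_le_card_nsmul _ _ _ fun j _ => hC j)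
  rw [h1, norm_mul, norm_inv, Complex.norm_natCast, one_sub_div hpos.ne', ← h3,
    add_sub_cancel_left, h3, div_mul_eq_mul_div, div_eq_inv_mul]
  gcongr

namespace Torus

variable {n : ℕ}

open UnitAddTorus in
theorem mFourier_eq_toCircle (k : Fin n → ℤ) (x : Torus n) :
    mFourier k x = (AddCircle.toCircle (∑ i, k i • x i) : ℂ) := by
  have h : AddCircle.toCircle (∑ i, k i • x i) = ∏ i, AddCircle.toCircle (k i • x i) :=
    map_sum (AddMonoidHom.mk' (fun y : AddCircle (1 : ℝ) => Additive.ofMul (AddCircle.toCircle y))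
      fun y z => congrArg Additive.ofMul (AddCircle.toCircle_add y z)) _ _
  rw [h]
  exact (map_prod Circle.coeHom (fun i => AddCircle.toCircle (k i • x i)) Finset.univ).symm

open UnitAddTorus in
theorem norm_mFourier_apply (k : Fin n → ℤ) (x : Torus n) : ‖mFourier k x‖ = 1 := by
  rw [mFourier_eq_toCircle, Circle.norm_coe]

open UnitAddTorus in
theorem mFourier_mulMap (A : Matrix (Fin n) (Fin n) ℤ) (k : Fin n → ℤ) (x : Torus n) :
    mFourier k (mulMap A x) = mFourier (k ᵥ* A) x := by
  rw [mFourier_eq_toCircle, mFourier_eq_toCircle]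
  simp only [mulMap, vecMul, dotProduct, Finset.smul_sum, Finset.sum_smul, smul_smul]
  rw [Finset.sum_comm]

theorem continuous_mulMap (A : Matrix (Fin n) (Fin n) ℤ) : Continuous (mulMap A) := by
  unfold mulMap
  fun_prop

theorem mulMap_mul (A B : Matrix (Fin n) (Fin n) ℤ) (x : Torus n) :
    mulMap (A * B) x = mulMap A (mulMap B x) := by
  funext i
  simp only [mulMap, Matrix.mul_apply, Finset.smul_sum, Finset.sum_smul, smul_smul]
  rw [Finset.sum_comm]

theorem mulMap_pow (A : Matrix (Fin n) (Fin n) ℤ) (j : ℕ) (x : Torus n) :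
    mulMap (A ^ j) x = (mulMap A)^[j] x := by
  induction j with
  | zero => funext i; simp [mulMap, Matrix.one_apply]
  | succ j ih => rw [pow_succ', mulMap_mul, ih, Function.iterate_succ_apply']

open UnitAddTorus in
theorem fourierCoef_eq_integral_mFourier (μ : Measure (Torus n)) (k : Fin n → ℤ) :
    fourierCoef μ k = ∫ x, mFourier k x ∂μ := rfl

open UnitAddTorus in
theorem fourierCoef_vecMul_of_map_eq {μ : Measure (Torus n)} {A : Matrix (Fin n) (Fin n) ℤ}
    (h : Measure.map (mulMap A) μ = μ) (k : Fin n → ℤ) :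
    fourierCoef μ (k ᵥ* A) = fourierCoef μ k := by
  simp only [fourierCoef_eq_integral_mFourier]
  conv_rhs => rw [← h]
  rw [integral_map (continuous_mulMap A).aemeasurable
    (ContinuousMap.continuous _).aestronglyMeasurable]
  simp only [mFourier_mulMap]

open UnitAddTorus in
theorem norm_fourierCoef_le (μ : Measure (Torus n)) [IsProbabilityMeasure μ] (k : Fin n → ℤ) :
    ‖fourierCoef μ k‖ ≤ 1 := by
  rw [fourierCoef_eq_integral_mFourier]
  simpa using norm_integral_le_of_norm_le_const (μ := μ)
    (.of_forall fun x => (norm_mFourier_apply k x).le)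

open UnitAddTorus in
theorem ext_of_fourierCoef {μ ν : Measure (Torus n)} [IsFiniteMeasure μ] [IsFiniteMeasure ν]
    (h : ∀ k, fourierCoef μ k = fourierCoef ν k) : μ = ν := by
  have hInt (ρ : Measure (Torus n)) [IsFiniteMeasure ρ] (g : C(Torus n, ℂ)) : Integrable g ρ :=
    g.continuous.integrable_of_hasCompactSupport (HasCompactSupport.of_compactSpace _)
  have hcont (ρ : Measure (Torus n)) [IsFiniteMeasure ρ] :
      Continuous fun g : C(Torus n, ℂ) => ∫ x, g x ∂ρ := by
    have h1 (g : C(Torus n, ℂ)) :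
        ∫ x, g x ∂ρ = ∫ x, ContinuousMap.toLp (E := ℂ) 1 ρ ℂ g x ∂ρ :=
      integral_congr_ae (ContinuousMap.coeFn_toLp ρ g).symm
    simp only [h1]
    exact continuous_integral.comp (ContinuousMap.toLp (E := ℂ) 1 ρ ℂ).continuous
  have hC (g : C(Torus n, ℂ)) : ∫ x, g x ∂μ = ∫ x, g x ∂ν := by
    have hg : g ∈ (Submodule.span ℂ (Set.range (mFourier (d := Fin n)))).topologicalClosure := by
      rw [span_mFourier_closure_eq_top]; trivial
    refine closure_minimal (fun f hf => ?_) (isClosed_eq (hcont μ) (hcont ν)) hg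
    refine Submodule.span_induction (p := fun f _ => ∫ x, f x ∂μ = ∫ x, f x ∂ν) ?_ ?_ ?_ ?_ hf
    · rintro _ ⟨k, rfl⟩
      exact h k
    · simp
    · intro f g _ _ hf hg
      simp only [ContinuousMap.add_apply]
      rw [integral_add (hInt μ f) (hInt μ g), integral_add (hInt ν f) (hInt ν g), hf, hg]
    · intro c f _ hf
      simp only [ContinuousMap.smul_apply, integral_smul, hf]
  refine ext_of_forall_integral_eq_of_IsFiniteMeasure fun f => ?_
  have h1 := hC ⟨fun x => (f x : ℂ), by fun_prop⟩
  simp only [ContinuousMap.coe_mk, integral_complex_ofReal] at h1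
  exact_mod_cast h1

instance : IsProbabilityMeasure (volume : Measure (AddCircle (1 : ℝ))) :=
  ⟨by simp [AddCircle.measure_univ]⟩

theorem fourierCoef_volume_eq_zero {k : Fin n → ℤ} (hk : k ≠ 0) :
    fourierCoef (volume : Measure (Torus n)) k = 0 := by
  rw [fourierCoef, integral_fintype_prod_volume_eq_prod]
  obtain ⟨i, hi⟩ := Function.ne_iff.mp hk
  refine Finset.prod_eq_zero (Finset.mem_univ i) ?_
  have h := congrFun (fourierCoeff_fourier (T := 1) (k i)) 0
  rw [Pi.single_eq_of_ne (show (0 : ℤ) ≠ k i from hi.symm), fourierCoeff, AddCircle.integral_haarAddCircle] at h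
  simpa using h

theorem fourierCoef_zero (μ : Measure (Torus n)) [IsProbabilityMeasure μ] :
    fourierCoef μ 0 = 1 := by
  simp [fourierCoef]

theorem ae_sum_smul_eq_zero_of_fourierCoef_eq_one {μ : Measure (Torus n)} [IsProbabilityMeasure μ]
    {k : Fin n → ℤ} (h : fourierCoef μ k = 1) : ∀ᵐ x ∂μ, ∑ i, k i • x i = 0 := by
  rw [fourierCoef_eq_integral_mFourier] at h
  have hInt : Integrable (UnitAddTorus.mFourier k) μ :=
    (ContinuousMap.continuous _).integrable_of_hasCompactSupport
      (HasCompactSupport.of_compactSpace _)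
  have hle (x : Torus n) : (UnitAddTorus.mFourier k x).re ≤ 1 :=
    (Complex.re_le_norm _).trans_eq (norm_mFourier_apply k x)
  have hre : ∫ x, (1 - (UnitAddTorus.mFourier k x).re) ∂μ = 0 := by
    have h1 : ∫ x, (UnitAddTorus.mFourier k x).re ∂μ = 1 := by
      have := integral_re hInt
      simp only [RCLike.re_eq_complex_re] at this
      rw [this, h, Complex.one_re]
    have := integral_sub (integrable_const (1 : ℝ)) hInt.re
    simp only [RCLike.re_eq_complex_re] at this
    rw [this, h1]
    simp
  rw [integral_eq_zero_iff_of_nonneg (fun x => sub_nonneg.2 (hle x))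
    ((integrable_const _).sub hInt.re)] at hre
  filter_upwards [hre] with x hx
  have hx1 : (UnitAddTorus.mFourier k x).re = 1 := (sub_eq_zero.1 hx).symm
  have hx2 : UnitAddTorus.mFourier k x = 1 := by
    have hn := norm_mFourier_apply k x
    have hsq := Complex.sq_norm (UnitAddTorus.mFourier k x)
    rw [hn, Complex.normSq_apply, hx1] at hsq
    refine Complex.ext hx1 ?_
    rw [Complex.one_im]
    nlinarith
  rw [mFourier_eq_toCircle] at hx2
  refine AddCircle.injective_toCircle (T := 1) one_ne_zero ?_
  rw [AddCircle.toCircle_zero]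
  exact Circle.ext hx2

theorem countable_setOf_zsmul_eq_zero {d : ℤ} (hd : d ≠ 0) :
    {y : AddCircle (1 : ℝ) | d • y = 0}.Countable := by
  refine (Set.countable_range fun m : ℤ => (((m : ℝ) / d : ℝ) : AddCircle (1 : ℝ))).mono
    fun y hy => ?_
  induction y using QuotientAddGroup.induction_on with
  | H t =>
    have hy' : ((d • t : ℝ) : AddCircle (1 : ℝ)) = 0 := hy
    obtain ⟨m, hm⟩ := (AddCircle.coe_eq_zero_iff (1 : ℝ)).1 hy'
    refine ⟨m, ?_⟩
    have hd' : (d : ℝ) ≠ 0 := by exact_mod_cast hd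
    have : (m : ℝ) / d = t := by
      rw [div_eq_iff hd']
      simp only [zsmul_eq_mul, mul_one] at hm
      rw [hm, mul_comm]
    simp only [this]

theorem countable_setOf_mulMap_eq_zero {C : Matrix (Fin n) (Fin n) ℤ} (hC : C.det ≠ 0) :
    {x : Torus n | mulMap C x = 0}.Countable := by
  refine (Set.countable_univ_pi fun _ : Fin n => countable_setOf_zsmul_eq_zero hC).mono ?_
  intro x hx i _
  have h1 : mulMap (C.adjugate * C) x = 0 := by
    rw [mulMap_mul, show mulMap C x = 0 from hx]
    funext i
    simp [mulMap]
  have h2 := congrFun h1 i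
  simpa [Matrix.adjugate_mul, mulMap, Matrix.smul_apply, Matrix.one_apply] using h2

theorem det_ne_zero_of_linearIndependent_rows {C : Matrix (Fin n) (Fin n) ℤ}
    (h : LinearIndependent ℝ fun i j => (C i j : ℝ)) : C.det ≠ 0 := by
  have h1 : IsUnit (C.map (Int.cast : ℤ → ℝ)) := Matrix.linearIndependent_rows_iff_isUnit.1 h
  rw [Matrix.isUnit_iff_isUnit_det] at h1
  intro h0
  have h2 := (Int.castRingHom ℝ).map_det C
  rw [h0, map_zero] at h2
  exact h1.ne_zero h2.symm

/-- If `μ` has no atoms, then `μ̂(cᵢ) ≠ 1` for some row `cᵢ` of a nonsingular matrix. -/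
theorem exists_fourierCoef_ne_one {μ : Measure (Torus n)} [IsProbabilityMeasure μ]
    [NullSingletonClass μ] {C : Matrix (Fin n) (Fin n) ℤ} (hC : C.det ≠ 0) :
    ∃ i, fourierCoef μ (C i) ≠ 1 := by
  by_contra! h
  have h1 : ∀ᵐ x ∂μ, mulMap C x = 0 := by
    filter_upwards [ae_all_iff.2 fun i => ae_sum_smul_eq_zero_of_fourierCoef_eq_one (h i)]
      with x hx
    exact funext hx
  have h2 : ∀ᵐ x ∂μ, x ∉ {x : Torus n | mulMap C x = 0} :=
    measure_eq_zero_iff_ae_notMem.1 ((countable_setOf_mulMap_eq_zero hC).measure_zero μ)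
  obtain ⟨x, hx, hx'⟩ := (h1.and h2).exists
  exact hx' hx

/-- If an ergodic `×A`-invariant measure is `×(Aʲ + B)`-invariant for a set of `j` of density one,
then `μ̂(k) = μ̂(k) μ̂(kB)`. -/
theorem fourierCoef_eq_mul_of_map_eq {A B : Matrix (Fin n) (Fin n) ℤ} {μ : Measure (Torus n)}
    [IsProbabilityMeasure μ] (herg : Ergodic (mulMap A) μ) {F : ℕ → Finset ℕ} (hF : IsFolner F)
    {E : Set ℕ} [DecidablePred (· ∈ E)]
    (hE : Tendsto (fun m => (((F m).filter (· ∈ E)).card : ℝ) / (F m).card) atTop (nhds 1))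
    (hinv : ∀ j ∈ E, Measure.map (mulMap (A ^ j + B)) μ = μ) (k : Fin n → ℤ) :
    fourierCoef μ k = fourierCoef μ k * fourierCoef μ (k ᵥ* B) := by
  have hmem (l : Fin n → ℤ) : MemLp (UnitAddTorus.mFourier l) 2 μ :=
    MemLp.of_bound (ContinuousMap.continuous _).aestronglyMeasurable 1
      (.of_forall fun x => (norm_mFourier_apply l x).le)
  have h1 := hF.tendsto_average_integral_mul herg (eventually_nonempty_of_density_one hE)
    (hmem k) (hmem (k ᵥ* B))
  have hcoef (j : ℕ) : ∫ x, UnitAddTorus.mFourier k ((mulMap A)^[j] x) *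
      UnitAddTorus.mFourier (k ᵥ* B) x ∂μ = fourierCoef μ (k ᵥ* (A ^ j + B)) := by
    rw [fourierCoef_eq_integral_mFourier]
    simp only [← mulMap_pow, mFourier_mulMap, ← UnitAddTorus.mFourier_add, Matrix.vecMul_add]
  simp only [hcoef] at h1
  refine tendsto_nhds_unique (tendsto_average_of_density_one hE (C := 1 + 1) (fun j => ?_)
    fun j hj => fourierCoef_vecMul_of_map_eq (hinv j hj) k) h1
  exact (norm_sub_le _ _).trans
    (add_le_add (norm_fourierCoef_le μ _) (norm_fourierCoef_le μ _))

end Torus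

theorem stmt0 {n : ℕ} (hn : 0 < n) (A : Matrix (Fin n) (Fin n) ℤ)
    (μ : Measure (Torus n)) [IsProbabilityMeasure μ]
    (hna : ∀ x : Torus n, μ {x} = 0)
    (herg : Ergodic (mulMap A) μ)
    (B : Fin n → Matrix (Fin n) (Fin n) ℤ)
    (hBGL : ∀ i, IsUnit (B i).det)
    (hSI : StronglyIndependent B)
    (F : ℕ → Finset ℕ) (hF : IsFolner F)
    (E : Set ℕ) [DecidablePred (· ∈ E)]
    (hE : Tendsto (fun m => (((F m).filter (· ∈ E)).card : ℝ) / (F m).card) atTop (nhds 1))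
    (hinv : ∀ j ∈ E, ∀ i : Fin n, Measure.map (mulMap (A ^ j + B i)) μ = μ) :
    μ = volume := by
  have : NullSingletonClass μ := ⟨hna⟩
  refine Torus.ext_of_fourierCoef fun k => ?_
  by_cases hk : k = 0
  · rw [hk, Torus.fourierCoef_zero, Torus.fourierCoef_zero]
  rw [Torus.fourierCoef_volume_eq_zero hk]
  by_contra hne
  obtain ⟨i, hi⟩ := Torus.exists_fourierCoef_ne_one (μ := μ)
    (Torus.det_ne_zero_of_linearIndependent_rows (C := fun i => k ᵥ* B i) (hSI k hk))
  have h := Torus.fourierCoef_eq_mul_of_map_eq herg hF hE (fun j hj => hinv j hj i) k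
  exact hi ((mul_eq_left₀ hne).1 h.symm)
end
end

section
/- Let A ∈ M(n,ℤ) and let μ be a non-atomic Borel probability measure on 𝕋ⁿ = ℝⁿ/ℤⁿ that is invariant and weakly mixing under the ×A map T_A. Suppose there exist matrices B₁, …, Bₙ ∈ GL(n,ℤ) that are strongly independent over ℤⁿ∖{0}, a Følner sequence Σ = {F_m} in ℕ, and a set E ⊆ ℕ with upper density D̄_Σ(E) > 0, such that μ is invariant under the ×(Aʲ + Bᵢ) map for every j ∈ E and every i = 1, …, n. Then μ is the Lebesgue (Haar) measure on 𝕋ⁿ. -/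
open MeasureTheory Filter Matrix

noncomputable section

theorem tendsto_average_coboundary {H : Type*} [NormedAddCommGroup H] [InnerProductSpace ℂ H]
    (U : H →ₗᵢ[ℂ] H) {F : ℕ → Finset ℕ} (hF : IsFolner F) (v : H) :
    Tendsto (fun m => ((F m).card : ℂ)⁻¹ • ∑ j ∈ F m, U^[j] (U v - v)) atTop (nhds 0) := by
  have hnorm : ∀ j, ‖U^[j] v‖ = ‖v‖ := fun j => by
    induction j with
    | zero => rfl
    | succ j ih => rw [Function.iterate_succ_apply', U.norm_map, ih]
  have hlim := (hF 1).mul_const ‖v‖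
  rw [zero_mul] at hlim
  refine squeeze_zero_norm (fun m => ?_) hlim
  have hsum : ∑ j ∈ F m, U^[j] (U v - v) =
      ∑ j ∈ (F m).image (· + 1), U^[j] v - ∑ j ∈ F m, U^[j] v := by
    rw [Finset.sum_image (by intro a _ b _ h; simpa using h), ← Finset.sum_sub_distrib]
    refine Finset.sum_congr rfl fun j _ => ?_
    rw [iterate_map_sub, ← Function.iterate_succ_apply]
  rw [hsum, ← Finset.sum_sdiff_sub_sum_sdiff, norm_smul, norm_inv, Complex.norm_natCast,
    div_mul_eq_mul_div, inv_mul_eq_div]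
  gcongr
  calc _ ≤ ‖∑ j ∈ (F m).image (· + 1) \ F m, U^[j] v‖
        + ‖∑ j ∈ F m \ (F m).image (· + 1), U^[j] v‖ := norm_sub_le _ _
    _ ≤ (((F m).image (· + 1) \ F m).card : ℝ) * ‖v‖
        + ((F m \ (F m).image (· + 1)).card : ℝ) * ‖v‖ := by
      gcongr <;>
      · refine (norm_sum_le _ _).trans ?_
        simp [hnorm]
    _ = _ := by
      rw [symmDiff_def, Finset.sup_eq_union, Finset.card_union_of_disjoint disjoint_sdiff_sdiff]
      push_cast
      ring

/-- The mean ergodic theorem along a Følner sequence, for a vector orthogonal to the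
fixed vectors. -/
theorem tendsto_average_zero {H : Type*} [NormedAddCommGroup H] [InnerProductSpace ℂ H]
    [CompleteSpace H] (U : H →ₗᵢ[ℂ] H) {F : ℕ → Finset ℕ} (hF : IsFolner F) (h : H)
    (hh : ∀ w, U w = w → inner ℂ w h = 0) :
    Tendsto (fun m => ((F m).card : ℂ)⁻¹ • ∑ j ∈ F m, U^[j] h) atTop (nhds 0) := by
  have hnorm : ∀ j v, ‖U^[j] v‖ = ‖v‖ := fun j v => by
    induction j with
    | zero => rfl
    | succ j ih => rw [Function.iterate_succ_apply', U.norm_map, ih]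
  have hmem : h ∈ (LinearMap.range (U.toLinearMap - 1)).topologicalClosure := by
    rw [← Submodule.orthogonal_orthogonal_eq_closure, Submodule.mem_orthogonal]
    intro w hw
    apply hh
    have hw' : ∀ y, inner ℂ (U y) w = inner ℂ y w := by
      simpa [Submodule.mem_orthogonal, inner_sub_left, sub_eq_zero] using hw
    exact eq_of_norm_le_re_inner_eq_norm_sq (𝕜 := ℂ) (U.norm_map w).le
      (by rw [hw', ← norm_sq_eq_re_inner])
  rw [Metric.tendsto_nhds]
  intro ε hε
  obtain ⟨y, ⟨v, rfl⟩, hy⟩ := Metric.mem_closure_iff.1 hmem (ε / 2) (half_pos hε)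
  have hv := (Metric.tendsto_nhds.1 (tendsto_average_coboundary U hF v)) (ε / 2) (half_pos hε)
  filter_upwards [hv] with m hm
  rw [dist_zero_right] at hm ⊢
  have hsplit : ((F m).card : ℂ)⁻¹ • ∑ j ∈ F m, U^[j] h =
      ((F m).card : ℂ)⁻¹ • ∑ j ∈ F m, U^[j] (h - (U v - v))
      + ((F m).card : ℂ)⁻¹ • ∑ j ∈ F m, U^[j] (U v - v) := by
    rw [← smul_add, ← Finset.sum_add_distrib]
    simp [iterate_map_sub]
  have hsmall : ‖((F m).card : ℂ)⁻¹ • ∑ j ∈ F m, U^[j] (h - (U v - v))‖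
      ≤ ‖h - (U v - v)‖ := by
    rw [norm_smul, norm_inv, Complex.norm_natCast]
    calc _ ≤ ((F m).card : ℝ)⁻¹ * (((F m).card : ℝ) * ‖h - (U v - v)‖) := by
          gcongr
          refine (norm_sum_le _ _).trans ?_
          simp only [hnorm, Finset.sum_const, nsmul_eq_mul, le_refl]
      _ ≤ _ := by
          rw [← mul_assoc]
          exact mul_le_of_le_one_left (norm_nonneg _) inv_mul_le_one
  have hy' : ‖h - (U v - v)‖ < ε / 2 := by simpa [dist_eq_norm] using hy
  rw [hsplit]
  linarith [norm_add_le (((F m).card : ℂ)⁻¹ • ∑ j ∈ F m, U^[j] (h - (U v - v)))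
    (((F m).card : ℂ)⁻¹ • ∑ j ∈ F m, U^[j] (U v - v))]

theorem tendsto_average_correlation_of_integral_eq_zero {X : Type*} [MeasurableSpace X]
    {ν : Measure X} [IsProbabilityMeasure ν] {S : X → X} (hS : Ergodic S ν)
    {F : ℕ → Finset ℕ} (hF : IsFolner F) {f g : X → ℂ} (hf : MemLp f 2 ν) (hg : MemLp g 2 ν)
    (hf0 : ∫ x, f x ∂ν = 0) :
    Tendsto (fun m => ((F m).card : ℂ)⁻¹ * ∑ j ∈ F m, ∫ x, f (S^[j] x) * g x ∂ν)
      atTop (nhds 0) := by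
  have hmp := hS.toMeasurePreserving
  have key := tendsto_average_zero (Lp.compMeasurePreservingₗᵢ (E := ℂ) (p := 2) ℂ S hmp) hF
    hf.toLp (fun w hw => by
      have hae : (w : X → ℂ) ∘ S =ᵐ[ν] w :=
        (Lp.coeFn_compMeasurePreserving w hmp).symm.trans (by
          have : Lp.compMeasurePreserving S hmp w = w := hw
          rw [this])
      obtain ⟨c, hc⟩ := hS.ae_eq_const_of_ae_eq_comp_ae (Lp.aestronglyMeasurable w) hae
      rw [L2.inner_def]
      have : ∀ᵐ x ∂ν, inner ℂ (w x) (hf.toLp f x) = f x * star c := by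
        filter_upwards [hc, hf.coeFn_toLp] with x h1 h2
        rw [h1, h2]
        simp
      rw [integral_congr_ae this, integral_mul_const, hf0, zero_mul])
  have hgs : MemLp (star g) 2 ν := hg.star
  have key2 := ((innerSL ℂ hgs.toLp).continuous.tendsto _).comp key
  rw [map_zero] at key2
  refine key2.congr fun m => ?_
  simp only [Function.comp_apply, map_smul, map_sum, smul_eq_mul, innerSL_apply_apply]
  congr 1
  refine Finset.sum_congr rfl fun j _ => ?_
  have hit : (Lp.compMeasurePreservingₗᵢ (E := ℂ) (p := 2) ℂ S hmp)^[j] hf.toLp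
      = Lp.compMeasurePreserving S^[j] (hmp.iterate j) hf.toLp := by
    exact congrFun (Lp.compMeasurePreserving_iterate (E := ℂ) (p := 2) hmp j) _
  rw [hit, Lp.toLp_compMeasurePreserving, L2.inner_def]
  refine integral_congr_ae ?_
  filter_upwards [hgs.coeFn_toLp, (hf.comp_measurePreserving (hmp.iterate j)).coeFn_toLp]
    with x h1 h2
  rw [h1, h2]
  simp

theorem memLp_two_prod_mul {X : Type*} [MeasurableSpace X] {μ : Measure X} [IsProbabilityMeasure μ]
    {f g : X → ℂ} {C D : ℝ} (hf : AEStronglyMeasurable f μ) (hfC : ∀ x, ‖f x‖ ≤ C)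
    (hg : AEStronglyMeasurable g μ) (hgD : ∀ x, ‖g x‖ ≤ D) :
    MemLp (fun p : X × X => f p.1 * g p.2) 2 (μ.prod μ) := by
  refine MemLp.of_bound (hf.comp_fst.mul hg.comp_snd) (C * D) (.of_forall fun p => ?_)
  rw [norm_mul]
  exact mul_le_mul (hfC _) (hgD _) (norm_nonneg _) ((norm_nonneg _).trans (hfC p.1))

/-- For a weakly mixing map, correlations with a function of mean zero tend to zero in
quadratic mean along a Følner sequence. -/
theorem tendsto_average_sq_correlation {X : Type*} [MeasurableSpace X]
    {μ : Measure X} [IsProbabilityMeasure μ] {T : X → X}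
    (hT : Ergodic (Prod.map T T) (μ.prod μ)) {F : ℕ → Finset ℕ} (hF : IsFolner F)
    {f g : X → ℂ} {C D : ℝ} (hf : AEStronglyMeasurable f μ) (hfC : ∀ x, ‖f x‖ ≤ C)
    (hg : AEStronglyMeasurable g μ) (hgD : ∀ x, ‖g x‖ ≤ D) (hf0 : ∫ x, f x ∂μ = 0) :
    Tendsto (fun m => ((F m).card : ℝ)⁻¹ * ∑ j ∈ F m, ‖∫ x, f (T^[j] x) * g x ∂μ‖ ^ 2)
      atTop (nhds 0) := by
  have key := (tendsto_average_correlation_of_integral_eq_zero hT hF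
    (memLp_two_prod_mul hf hfC hf.star (fun x => (norm_star (f x)).trans_le (hfC x)))
    (memLp_two_prod_mul hg hgD hg.star (fun x => (norm_star (g x)).trans_le (hgD x)))
    (by rw [integral_prod_mul, hf0, zero_mul])).norm
  rw [norm_zero] at key
  refine key.congr fun m => ?_
  have hterm : ∀ j, ∫ p : X × X, f ((Prod.map T T)^[j] p).1 * star f ((Prod.map T T)^[j] p).2
      * (g p.1 * star g p.2) ∂μ.prod μ = ((‖∫ x, f (T^[j] x) * g x ∂μ‖ ^ 2 : ℝ) : ℂ) := fun j => by
    have hconj : ∫ x, star (f (T^[j] x) * g x) ∂μ = star (∫ x, f (T^[j] x) * g x ∂μ) :=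
      integral_conj
    rw [Complex.ofReal_pow, ← Complex.mul_conj', starRingEnd_apply, ← hconj, ← integral_prod_mul]
    refine integral_congr_ae (.of_forall fun p => ?_)
    simp only [Prod.map_iterate, Prod.map_fst, Prod.map_snd, Pi.star_apply, star_mul']
    ring
  simp only [hterm]
  rw [← Complex.ofReal_sum, norm_mul, norm_inv, Complex.norm_natCast, Complex.norm_real,
    Real.norm_of_nonneg (by positivity)]

theorem eq_integral_mul_integral_of_correlation_eq {X : Type*} [MeasurableSpace X]
    {μ : Measure X} [IsProbabilityMeasure μ] {T : X → X} (hTμ : MeasurePreserving T μ μ)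
    (hT : Ergodic (Prod.map T T) (μ.prod μ)) {F : ℕ → Finset ℕ} (hF : IsFolner F)
    {E : Set ℕ} [DecidablePred (· ∈ E)]
    (hE : 0 < limsup (fun m => (((F m).filter (· ∈ E)).card : ℝ) / (F m).card) atTop)
    {f g : X → ℂ} {C D : ℝ} (hf : AEStronglyMeasurable f μ) (hfC : ∀ x, ‖f x‖ ≤ C)
    (hg : AEStronglyMeasurable g μ) (hgD : ∀ x, ‖g x‖ ≤ D) {d : ℂ}
    (hd : ∀ j ∈ E, ∫ x, f (T^[j] x) * g x ∂μ = d) :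
    d = (∫ x, f x ∂μ) * ∫ x, g x ∂μ := by
  set c := ∫ x, f x ∂μ with hc
  have hf1 : Integrable f μ := .of_bound hf C (.of_forall hfC)
  have hg1 : Integrable g μ := .of_bound hg D (.of_forall hgD)
  have key := tendsto_average_sq_correlation hT hF (f := fun x => f x - c) (C := C + ‖c‖)
    (hf.sub aestronglyMeasurable_const)
    (fun x => (norm_sub_le _ _).trans (by linarith [hfC x])) hg hgD
    (by rw [integral_sub hf1 (integrable_const c)]; simp [hc])
  have hcorr : ∀ j ∈ E, ∫ x, (f (T^[j] x) - c) * g x ∂μ = d - c * ∫ x, g x ∂μ := fun j hj => by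
    have hfg : Integrable (fun x => f (T^[j] x) * g x) μ :=
      hg1.bdd_mul (hf.comp_measurePreserving (hTμ.iterate j)) (.of_forall fun x => hfC _)
    simp only [sub_mul]
    rw [integral_sub hfg (hg1.const_mul c), integral_const_mul, hd j hj]
  by_contra hne
  have hpos : 0 < ‖d - c * ∫ x, g x ∂μ‖ ^ 2 := by
    have := norm_pos_iff.2 (sub_ne_zero.2 hne)
    positivity
  obtain ⟨δ, hδ, hδE⟩ := exists_between hE
  have hfreq := frequently_lt_of_lt_limsup
    (Filter.IsCoboundedUnder.of_frequently_ge (a := 0) (.of_forall fun m => by positivity)) hδE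
  obtain ⟨m, hm1, hm2⟩ := (hfreq.and_eventually
    (key.eventually (gt_mem_nhds (mul_pos hδ hpos)))).exists
  refine absurd hm2 (not_lt.2 ?_)
  calc _ ≤ (((F m).filter (· ∈ E)).card : ℝ) / (F m).card * ‖d - c * ∫ x, g x ∂μ‖ ^ 2 := by gcongr
    _ = ((F m).card : ℝ)⁻¹ * ∑ j ∈ (F m).filter (· ∈ E),
          ‖∫ x, (f (T^[j] x) - c) * g x ∂μ‖ ^ 2 := by
      rw [Finset.sum_congr rfl fun j hj => by rw [hcorr j (Finset.mem_filter.1 hj).2]]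
      rw [Finset.sum_const, nsmul_eq_mul]
      ring
    _ ≤ _ := by
      gcongr
      exact Finset.filter_subset _ _

theorem continuous_mulMap {n : ℕ} (A : Matrix (Fin n) (Fin n) ℤ) : Continuous (mulMap A) := by
  unfold mulMap
  fun_prop

theorem mulMap_add {n : ℕ} (A B : Matrix (Fin n) (Fin n) ℤ) (x : Torus n) :
    mulMap (A + B) x = mulMap A x + mulMap B x := by
  ext i
  simp [mulMap, add_smul, Finset.sum_add_distrib]

theorem mulMap_mul {n : ℕ} (A B : Matrix (Fin n) (Fin n) ℤ) (x : Torus n) :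
    mulMap (A * B) x = mulMap A (mulMap B x) := by
  ext i
  simp only [mulMap, Matrix.mul_apply, Finset.sum_smul, Finset.smul_sum, mul_smul]
  exact Finset.sum_comm

theorem mulMap_smul_one {n : ℕ} (d : ℤ) (x : Torus n) :
    mulMap (d • (1 : Matrix (Fin n) (Fin n) ℤ)) x = d • x := by
  ext i
  simp [mulMap, Matrix.one_apply, ite_smul]

theorem mulMap_pow {n : ℕ} (A : Matrix (Fin n) (Fin n) ℤ) (j : ℕ) (x : Torus n) :
    mulMap (A ^ j) x = (mulMap A)^[j] x := by
  induction j with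
  | zero => simpa using mulMap_smul_one 1 x
  | succ j ih => rw [pow_succ', mulMap_mul, ih, Function.iterate_succ_apply']

theorem mFourier_apply_add {n : ℕ} (k : Fin n → ℤ) (x y : Torus n) :
    UnitAddTorus.mFourier k (x + y) = UnitAddTorus.mFourier k x * UnitAddTorus.mFourier k y := by
  simp [UnitAddTorus.mFourier, Finset.prod_mul_distrib, fourier_apply, smul_add,
    AddCircle.toCircle_add]

theorem mFourier_eq_toCircle {n : ℕ} (k : Fin n → ℤ) (x : Torus n) :
    UnitAddTorus.mFourier k x = AddCircle.toCircle (∑ i, k i • x i) := by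
  simp only [UnitAddTorus.mFourier, ContinuousMap.coe_mk, fourier_apply]
  induction (Finset.univ : Finset (Fin n)) using Finset.induction_on with
  | empty => simp
  | insert a s ha ih => rw [Finset.prod_insert ha, Finset.sum_insert ha, ih,
      AddCircle.toCircle_add, Circle.coe_mul]

theorem norm_mFourier_apply {n : ℕ} (k : Fin n → ℤ) (x : Torus n) :
    ‖UnitAddTorus.mFourier k x‖ = 1 := by
  rw [mFourier_eq_toCircle, Circle.norm_coe]

theorem mFourier_mulMap {n : ℕ} (k : Fin n → ℤ) (B : Matrix (Fin n) (Fin n) ℤ) (x : Torus n) :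
    UnitAddTorus.mFourier k (mulMap B x) = UnitAddTorus.mFourier (k ᵥ* B) x := by
  simp only [mFourier_eq_toCircle, mulMap, Matrix.vecMul, dotProduct, Finset.sum_smul,
    Finset.smul_sum, mul_smul]
  rw [Finset.sum_comm]

theorem ae_mFourier_eq_one {n : ℕ} {μ : Measure (Torus n)} [IsProbabilityMeasure μ]
    {k : Fin n → ℤ} (hk : ∫ x, UnitAddTorus.mFourier k x ∂μ = 1) :
    ∀ᵐ x ∂μ, UnitAddTorus.mFourier k x = 1 := by
  have hint : Integrable (fun x => UnitAddTorus.mFourier k x) μ :=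
    .of_bound (UnitAddTorus.mFourier k).continuous.aestronglyMeasurable 1
      (.of_forall fun x => (norm_mFourier_apply k x).le)
  have hint' : Integrable (fun x => (UnitAddTorus.mFourier k x).re) μ := hint.re
  have hre : ∫ x, (1 - (UnitAddTorus.mFourier k x).re) ∂μ = 0 := by
    have h1 : ∫ x, (UnitAddTorus.mFourier k x).re ∂μ = 1 := by
      have := integral_re hint
      simpa [hk] using this
    rw [integral_sub (integrable_const _) hint', h1]
    simp
  have hle : ∀ x, (UnitAddTorus.mFourier k x).re ≤ 1 := fun x =>
    (Complex.re_le_norm _).trans (norm_mFourier_apply k x).le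
  rw [integral_eq_zero_iff_of_nonneg (fun x => sub_nonneg.2 (hle x))
    ((integrable_const _).sub hint')] at hre
  filter_upwards [hre] with x hx
  have hx1 : (UnitAddTorus.mFourier k x).re = 1 := (sub_eq_zero.1 hx).symm
  have hn := norm_mFourier_apply k x
  have hsq := Complex.sq_norm (UnitAddTorus.mFourier k x)
  rw [Complex.normSq_apply, hn, hx1] at hsq
  have him : (UnitAddTorus.mFourier k x).im = 0 := by nlinarith
  exact Complex.ext (by simpa using hx1) (by simpa using him)

theorem finite_mulMap_eq_zero {n : ℕ} {M : Matrix (Fin n) (Fin n) ℤ} (hM : M.det ≠ 0) :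
    {x : Torus n | mulMap M x = 0}.Finite := by
  refine (Set.Finite.pi' (t := fun _ : Fin n => {u : AddCircle (1 : ℝ) | M.det.natAbs • u = 0})
    fun _ => AddCircle.finite_torsion 1 (Int.natAbs_pos.2 hM)).subset fun x hx i => ?_
  have hx0 : mulMap M x = 0 := hx
  have h : M.det • x = 0 := by
    rw [← mulMap_smul_one, ← Matrix.adjugate_mul, mulMap_mul, hx0]
    ext i
    simp [mulMap]
  exact natAbs_nsmul_eq_zero.2 (congrFun h i)

theorem integral_fourier_eq_zero {k : ℤ} (hk : k ≠ 0) :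
    ∫ x : AddCircle (1 : ℝ), fourier k x = 0 :=
  integral_eq_zero_of_add_right_eq_neg (fourier_add_half_inv_index hk one_pos)

theorem integral_mFourier_volume {n : ℕ} {k : Fin n → ℤ} (hk : k ≠ 0) :
    ∫ x : Torus n, UnitAddTorus.mFourier k x = 0 := by
  obtain ⟨i, hi⟩ := Function.ne_iff.1 hk
  have := integral_fintype_prod_volume_eq_prod (𝕜 := ℂ)
    (fun (i : Fin n) (x : AddCircle (1 : ℝ)) => fourier (k i) x)
  exact this.trans (Finset.prod_eq_zero (Finset.mem_univ i) (integral_fourier_eq_zero hi))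

/-- A Borel probability measure on the torus is determined by its Fourier coefficients. -/
theorem eq_volume_of_integral_mFourier_eq_zero {n : ℕ} {μ : Measure (Torus n)}
    [IsProbabilityMeasure μ] (h : ∀ k ≠ 0, ∫ x, UnitAddTorus.mFourier k x ∂μ = 0) :
    μ = volume := by
  have hvol : IsProbabilityMeasure (volume : Measure (AddCircle (1 : ℝ))) :=
    ⟨by simp⟩
  have hint : ∀ (ν : Measure (Torus n)) [IsProbabilityMeasure ν] (g : C(Torus n, ℂ)),
      Integrable g ν := fun ν _ g =>
    .of_bound g.continuous.aestronglyMeasurable ‖g‖ (.of_forall g.norm_coe_le_norm)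
  let e := BoundedContinuousFunction.toContinuousMapStarₐ ℂ (α := Torus n) (β := ℂ)
  refine ext_of_forall_mem_subalgebra_integral_eq_of_polish (𝕜 := ℂ)
    (A := (UnitAddTorus.mFourierSubalgebra (Fin n)).comap e) ?_ ?_
  · intro x y hxy
    obtain ⟨_, ⟨g, hg, rfl⟩, hne⟩ := UnitAddTorus.mFourierSubalgebra_separatesPoints hxy
    exact ⟨_, ⟨g, ⟨BoundedContinuousFunction.mkOfCompact g, hg, rfl⟩, rfl⟩, hne⟩
  · intro g hg
    have hg' : e g ∈ Submodule.span ℂ (Set.range UnitAddTorus.mFourier) := by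
      rw [← UnitAddTorus.mFourierSubalgebra_coe]
      exact hg
    change ∫ x, e g x ∂μ = ∫ x, e g x
    generalize e g = f at hg'
    induction hg' using Submodule.span_induction with
    | mem f hf =>
      obtain ⟨k, rfl⟩ := hf
      by_cases hk : k = 0
      · simp [hk, UnitAddTorus.mFourier_zero]
      · rw [h k hk, integral_mFourier_volume hk]
    | zero => simp
    | add f₁ f₂ _ _ h₁ h₂ =>
      simp only [ContinuousMap.add_apply]
      rw [integral_add (hint μ f₁) (hint μ f₂), integral_add (hint _ f₁) (hint _ f₂), h₁, h₂]
    | smul a f _ hf =>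
      simp only [ContinuousMap.smul_apply]
      rw [integral_smul, integral_smul, hf]

theorem stmt1 {n : ℕ} (hn : 0 < n) (A : Matrix (Fin n) (Fin n) ℤ)
    (μ : Measure (Torus n)) [IsProbabilityMeasure μ]
    (hna : ∀ x : Torus n, μ {x} = 0)
    (hinvA : Measure.map (mulMap A) μ = μ)
    (hwm : Ergodic (Prod.map (mulMap A) (mulMap A)) (μ.prod μ))
    (B : Fin n → Matrix (Fin n) (Fin n) ℤ)
    (hBGL : ∀ i, IsUnit (B i).det)
    (hSI : StronglyIndependent B)
    (F : ℕ → Finset ℕ) (hF : IsFolner F)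
    (E : Set ℕ) [DecidablePred (· ∈ E)]
    (hE : 0 < Filter.limsup
      (fun m => (((F m).filter (· ∈ E)).card : ℝ) / (F m).card) atTop)
    (hinv : ∀ j ∈ E, ∀ i : Fin n, Measure.map (mulMap (A ^ j + B i)) μ = μ) :
    μ = volume := by
  have hTμ : MeasurePreserving (mulMap A) μ μ := ⟨(continuous_mulMap A).measurable, hinvA⟩
  refine eq_volume_of_integral_mFourier_eq_zero fun k hk => ?_
  by_contra hne
  have hchar : ∀ (l : Fin n → ℤ), AEStronglyMeasurable (UnitAddTorus.mFourier l) μ := fun l =>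
    (UnitAddTorus.mFourier l).continuous.aestronglyMeasurable
  have hone : ∀ i, ∫ x, UnitAddTorus.mFourier (k ᵥ* B i) x ∂μ = 1 := fun i => by
    have heq := eq_integral_mul_integral_of_correlation_eq hTμ hwm hF hE
      (hchar k) (fun x => (norm_mFourier_apply k x).le)
      (hchar (k ᵥ* B i)) (fun x => (norm_mFourier_apply _ x).le)
      (d := ∫ x, UnitAddTorus.mFourier k x ∂μ) fun j hj => by
        conv_rhs => rw [← hinv j hj i]
        rw [integral_map (continuous_mulMap _).aemeasurable
          (UnitAddTorus.mFourier k).continuous.aestronglyMeasurable]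
        refine integral_congr_ae (.of_forall fun x => ?_)
        simp only [mulMap_add, mFourier_apply_add, mulMap_pow, mFourier_mulMap]
    exact mul_left_cancel₀ hne (by rw [← heq, mul_one])
  let M : Matrix (Fin n) (Fin n) ℤ := Matrix.of fun i => k ᵥ* B i
  have hdet : M.det ≠ 0 := by
    have hu : IsUnit (M.map (Int.cast : ℤ → ℝ)) :=
      Matrix.linearIndependent_rows_iff_isUnit.1 (hSI k hk)
    rw [Matrix.isUnit_iff_isUnit_det] at hu
    intro h0
    apply hu.ne_zero
    have := (Int.castRingHom ℝ).map_det M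
    rw [h0, map_zero] at this
    exact this.symm
  have hae : ∀ᵐ x ∂μ, mulMap M x = 0 := by
    filter_upwards [ae_all_iff.2 fun i => ae_mFourier_eq_one (hone i)] with x hx
    ext1 i
    have h1 := hx i
    rw [mFourier_eq_toCircle] at h1
    exact AddCircle.injective_toCircle one_ne_zero
      (Subtype.coe_injective (h1.trans (by simp)))
  have : NullSingletonClass μ := ⟨hna⟩
  have hnot : ∀ᵐ x ∂μ, ¬ mulMap M x = 0 :=
    measure_eq_zero_iff_ae_notMem.1 ((finite_mulMap_eq_zero hdet).measure_zero μ)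
  obtain ⟨x, hx, hx'⟩ := (hae.and hnot).exists
  exact hx' hx
end
end

section
/- Let n be a positive integer such that 2n+1 is a prime number, and let M_n(2) be the n×n integer tridiagonal matrix with diagonal entries 2 except the (n,n) entry which is 1, superdiagonal and subdiagonal entries 1, and all other entries 0. Then the matrices M_n(2), M_n(2)², …, M_n(2)ⁿ are strongly independent over ℤⁿ∖{0}, i.e., for every nonzero row vector k ∈ ℤⁿ the row vectors kM_n(2), kM_n(2)², …, kM_n(2)ⁿ are linearly independent over ℝ. -/
open Matrix Polynomial

noncomputable section

/-- The `n × n` real tridiagonal matrix `M_n(a)` with diagonal `(a, a, …, a, a-1)`,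
entries `1` on the super- and subdiagonal, and `0` elsewhere. -/
def Mmat (n : ℕ) (a : ℝ) : Matrix (Fin n) (Fin n) ℝ :=
  Matrix.of fun i j =>
    if (i : ℕ) = (j : ℕ) then (if (i : ℕ) = n - 1 then a - 1 else a)
    else if (i : ℕ) + 1 = (j : ℕ) ∨ (j : ℕ) + 1 = (i : ℕ) then 1 else 0

/-- The `n × n` real tridiagonal matrix `N_n(a)` with all diagonal entries `a`,
entries `1` on the super- and subdiagonal, and `0` elsewhere. -/
def Nmat (n : ℕ) (a : ℝ) : Matrix (Fin n) (Fin n) ℝ :=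
  Matrix.of fun i j =>
    if (i : ℕ) = (j : ℕ) then a
    else if (i : ℕ) + 1 = (j : ℕ) ∨ (j : ℕ) + 1 = (i : ℕ) then 1 else 0

/-- The integer matrix `M_n(2)`: tridiagonal with diagonal `(2, …, 2, 1)` and `1` on the
super- and subdiagonal. -/
def MmatInt (n : ℕ) : Matrix (Fin n) (Fin n) ℤ :=
  Matrix.of fun i j =>
    if (i : ℕ) = (j : ℕ) then (if (i : ℕ) = n - 1 then 1 else 2)
    else if (i : ℕ) + 1 = (j : ℕ) ∨ (j : ℕ) + 1 = (i : ℕ) then 1 else 0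

open Chebyshev in
/-- The Chebyshev polynomial `S n - S (n - 1)`, which takes `z ^ 2 + (z⁻¹) ^ 2` to
`(z ^ (2 * n + 1) + (z⁻¹) ^ (2 * n + 1)) / (z + z⁻¹)`. -/
def chebyshevV (R : Type*) [CommRing R] (n : ℕ) : R[X] :=
  S R n - S R ((n : ℤ) - 1)

namespace chebyshevV

section CommRing

variable (R : Type*) [CommRing R]

lemma zero : chebyshevV R 0 = 1 := by simp [chebyshevV]

lemma one : chebyshevV R 1 = X - 1 := by simp [chebyshevV]

lemma add_two (n : ℕ) :
    chebyshevV R (n + 2) = X * chebyshevV R (n + 1) - chebyshevV R n := by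
  have h₁ := Chebyshev.S_add_two R n
  have h₂ := Chebyshev.S_add_two R ((n : ℤ) - 1)
  simp only [chebyshevV, Nat.cast_add, Nat.cast_ofNat, Nat.cast_one]
  ring_nf at h₁ h₂ ⊢
  linear_combination h₁ - h₂

lemma X_mul_comp (n : ℕ) :
    X * (chebyshevV R n).comp (X ^ 2 - 2) = Chebyshev.C R (2 * n + 1) := by
  induction n using Nat.twoStepInduction with
  | zero => simp [zero]
  | one =>
    have h := Chebyshev.C_add_two R 1
    norm_num at h
    simp [one, h, Chebyshev.C_two]
    ring
  | more n ih₁ ih₂ =>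
    have h₁ := Chebyshev.C_add_two R (2 * n + 1)
    have h₂ := Chebyshev.C_add_two R (2 * n + 2)
    have h₃ := Chebyshev.C_add_two R (2 * n + 3)
    simp only [add_two, sub_comp, mul_comp, X_comp]
    push_cast at ih₁ ih₂ ⊢
    ring_nf at h₁ h₂ h₃ ih₁ ih₂ ⊢
    linear_combination (X ^ 2 - 2) * ih₂ - ih₁ - h₃ - X * h₂ - h₁

lemma monic_and_natDegree [Nontrivial R] (n : ℕ) :
    (chebyshevV R n).Monic ∧ (chebyshevV R n).natDegree = n := by
  induction n using Nat.twoStepInduction with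
  | zero => simp [zero]
  | one =>
    rw [one, ← map_one Polynomial.C]
    exact ⟨monic_X_sub_C _, natDegree_X_sub_C _⟩
  | more n ih₁ ih₂ =>
    have hX : (X * chebyshevV R (n + 1)).Monic := monic_X.mul ih₂.1
    have hd : (X * chebyshevV R (n + 1)).natDegree = n + 2 := by
      rw [monic_X.natDegree_mul ih₂.1, natDegree_X, ih₂.2]
      ring
    rw [add_two]
    refine ⟨hX.sub_of_left ?_, ?_⟩
    · apply degree_lt_degree
      lia
    · rw [natDegree_sub_eq_left_of_natDegree_lt (by lia), hd]

lemma map {R' : Type*} [CommRing R'] (f : R →+* R') (n : ℕ) :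
    (chebyshevV R n).map f = chebyshevV R' n := by
  simp [chebyshevV, Chebyshev.map_S]

lemma eval_two (n : ℕ) : (chebyshevV R n).eval 2 = 1 := by
  simp [chebyshevV]

lemma eval_neg_two (n : ℕ) :
    (chebyshevV R n).eval (-2) = (-1) ^ n * (2 * n + 1) := by
  induction n using Nat.twoStepInduction with
  | zero => simp [zero]
  | one => simp [one]; ring
  | more n ih₁ ih₂ =>
    simp only [add_two, eval_sub, eval_mul, eval_X, ih₁, ih₂]
    push_cast
    ring

end CommRing

/-- Reduction modulo the prime `2 * n + 1`. -/
lemma zmod_eq_pow (n : ℕ) [Fact (2 * n + 1).Prime] :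
    chebyshevV (ZMod (2 * n + 1)) n = (X + 2) ^ n := by
  have h := X_mul_comp (ZMod (2 * n + 1)) n
  have hC := dickson_one_one_zmod_p (2 * n + 1)
  rw [dickson_one_one_eq_chebyshev_C] at hC
  push_cast at hC
  rw [hC, pow_succ' X (2 * n), pow_mul] at h
  have h₁ := mul_left_cancel₀ X_ne_zero h
  have h₂ : ((X + 2 : (ZMod (2 * n + 1))[X]) ^ n).comp (X ^ 2 - 2) = (X ^ 2) ^ n := by
    simp
  have hd : (X ^ 2 - 2 : (ZMod (2 * n + 1))[X]).natDegree = 2 :=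
    natDegree_X_pow_sub_C (r := (2 : ZMod (2 * n + 1)))
  have h₃ : (chebyshevV (ZMod (2 * n + 1)) n - (X + 2) ^ n).comp (X ^ 2 - 2) = 0 := by
    rw [sub_comp, h₁, h₂, sub_self]
  refine sub_eq_zero.mp ((Polynomial.comp_eq_zero_iff.mp h₃).resolve_right fun h₄ => ?_)
  rw [h₄.2, natDegree_C] at hd
  lia

/-- The shift of `chebyshevV ℤ n` by `-2` is an Eisenstein polynomial at `2 * n + 1`. -/
lemma irreducible_comp {n : ℕ} (hn : 0 < n) (hp : (2 * n + 1).Prime) :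
    Irreducible ((chebyshevV ℤ n).comp (X - Polynomial.C 2)) := by
  have : Fact (2 * n + 1).Prime := ⟨hp⟩
  obtain ⟨hm, hd⟩ := monic_and_natDegree ℤ n
  have hm' : ((chebyshevV ℤ n).comp (X - Polynomial.C 2)).Monic := hm.comp_X_sub_C 2
  have hd' : ((chebyshevV ℤ n).comp (X - Polynomial.C 2)).natDegree = n := by
    rw [natDegree_comp, natDegree_X_sub_C, hd, mul_one]
  have hprime : (Ideal.span {((2 * n + 1 : ℕ) : ℤ)}).IsPrime :=
    (Ideal.span_singleton_prime (by exact_mod_cast hp.ne_zero)).mpr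
      (Nat.prime_iff_prime_int.mp hp)
  have hmap : ((chebyshevV ℤ n).comp (X - Polynomial.C 2)).map
      (Int.castRingHom (ZMod (2 * n + 1))) = X ^ n := by
    rw [Polynomial.map_comp, map, zmod_eq_pow]
    simp
  refine IsEisensteinAt.irreducible (𝓟 := Ideal.span {((2 * n + 1 : ℕ) : ℤ)})
    ⟨?_, ?_, ?_⟩ hprime hm'.isPrimitive (by lia)
  · rw [hm'.leadingCoeff]
    exact fun h => hprime.ne_top ((Ideal.eq_top_iff_one _).mpr h)
  · intro m hm
    rw [hd'] at hm
    rw [Ideal.mem_span_singleton, ← ZMod.intCast_zmod_eq_zero_iff_dvd]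
    have := congrArg (coeff · m) hmap
    simpa [coeff_X_pow, hm.ne] using this
  · rw [coeff_zero_eq_eval_zero, eval_comp, Ideal.span_singleton_pow,
      Ideal.mem_span_singleton]
    simp only [eval_sub, eval_X, eval_C, zero_sub, eval_neg_two]
    intro h
    rw [IsUnit.dvd_mul_left ((isUnit_neg_one).pow n)] at h
    have h₁ : (2 * n + 1) ^ 2 ∣ 2 * n + 1 := by exact_mod_cast h
    have := Nat.le_of_dvd (by lia) h₁
    nlinarith

end chebyshevV

/-- The vector `(-1) ^ j` times the `(j - 1)`-st standard basis vector, and `0` for `j = 0`. -/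
def alternatingBasis (n j : ℕ) : Fin n → ℤ :=
  fun i => if (i : ℕ) + 1 = j then (-1) ^ j else 0

lemma alternatingBasis_vecMul {n j : ℕ} (hj : j < n) (A : Matrix (Fin n) (Fin n) ℤ) :
    alternatingBasis n (j + 1) ᵥ* A = fun i => (-1) ^ (j + 1) * A ⟨j, hj⟩ i := by
  ext i
  rw [vecMul, dotProduct, Finset.sum_eq_single ⟨j, hj⟩]
  · simp [alternatingBasis]
  · intro b _ hb
    have : (b : ℕ) ≠ j := fun h => hb (Fin.ext h)
    simp [alternatingBasis, this]
  · simp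

lemma alternatingBasis_add_two {n j : ℕ} (hj : j + 1 < n) :
    alternatingBasis n (j + 2) =
      alternatingBasis n (j + 1) ᵥ* (2 - MmatInt n) - alternatingBasis n j := by
  rw [vecMul_sub, alternatingBasis_vecMul (by lia), alternatingBasis_vecMul (by lia)]
  ext i
  have hi := i.isLt
  simp only [alternatingBasis, MmatInt, Pi.sub_apply, of_apply, Matrix.ofNat_apply, Fin.ext_iff]
  split_ifs <;> lia

lemma alternatingBasis_last {n : ℕ} (hn : 0 < n) :
    alternatingBasis n n ᵥ* (2 - MmatInt n) - alternatingBasis n (n - 1)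
      - alternatingBasis n n = 0 := by
  obtain ⟨j, rfl⟩ := Nat.exists_eq_succ_of_ne_zero hn.ne'
  rw [vecMul_sub, alternatingBasis_vecMul (by lia), alternatingBasis_vecMul (by lia)]
  ext i
  have hi := i.isLt
  simp only [alternatingBasis, MmatInt, Pi.sub_apply, Pi.zero_apply, of_apply,
    Matrix.ofNat_apply, Fin.ext_iff, Nat.succ_eq_add_one, Nat.add_sub_cancel]
  split_ifs <;> lia

lemma alternatingBasis_succ {n j : ℕ} (hj : j < n) :
    alternatingBasis n (j + 1) =
      alternatingBasis n 1 ᵥ* aeval (2 - MmatInt n) (Chebyshev.S ℤ j) := by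
  induction j using Nat.twoStepInduction with
  | zero => simp
  | one =>
    rw [alternatingBasis_add_two hj]
    ext i
    simp [alternatingBasis]
  | more j ih₁ ih₂ =>
    rw [alternatingBasis_add_two (by lia), ih₁ (by lia), ih₂ (by lia)]
    push_cast
    rw [Chebyshev.S_add_two, mul_comm X]
    simp only [map_sub, map_mul, aeval_X, vecMul_sub, vecMul_vecMul, mul_sub]

lemma aeval_chebyshevV_MmatInt {n : ℕ} (hn : 0 < n) :
    aeval (2 - MmatInt n) (chebyshevV ℤ n) = 0 := by
  have h₀ : alternatingBasis n 1 ᵥ* aeval (2 - MmatInt n) (chebyshevV ℤ n) = 0 := by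
    rw [← alternatingBasis_last hn]
    obtain ⟨j, rfl⟩ := Nat.exists_eq_succ_of_ne_zero hn.ne'
    have hS := Chebyshev.S_add_one ℤ j
    have h₂ : alternatingBasis (j + 1) j =
        alternatingBasis (j + 1) 1 ᵥ* aeval (2 - MmatInt (j + 1)) (Chebyshev.S ℤ (j - 1)) := by
      cases j with
      | zero =>
        ext i
        simp [alternatingBasis]
      | succ j => simpa using alternatingBasis_succ (n := j + 2) (j := j) (by lia)
    simp only [Nat.succ_eq_add_one, Nat.add_sub_cancel]
    rw [alternatingBasis_succ (Nat.lt_succ_self j), h₂, chebyshevV]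
    push_cast
    rw [hS, add_sub_cancel_right, mul_comm X]
    simp only [map_sub, map_mul, aeval_X, vecMul_sub, vecMul_vecMul, mul_sub]
  ext i j
  have h : alternatingBasis n (i + 1) ᵥ* aeval (2 - MmatInt n) (chebyshevV ℤ n) = 0 := by
    rw [alternatingBasis_succ i.isLt, vecMul_vecMul, ← map_mul, mul_comm, map_mul,
      ← vecMul_vecMul, h₀, zero_vecMul]
  rw [alternatingBasis_vecMul i.isLt] at h
  simpa using congrFun h j

/-- A row vector killed by `aeval A q` is zero unless `q` is divisible by any given irreducible
polynomial annihilating `A`. -/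
lemma dvd_of_vecMul_aeval_eq_zero {ι K : Type*} [Fintype ι] [DecidableEq ι] [Field K]
    {A : Matrix ι ι K} {f q : K[X]} (hf : Irreducible f) (hA : aeval A f = 0)
    {k : ι → K} (hk : k ≠ 0) (hq : k ᵥ* aeval A q = 0) : f ∣ q := by
  by_contra h
  obtain ⟨a, b, hab⟩ := (hf.coprime_iff_not_dvd).mpr h
  apply hk
  have := congrArg (fun r => k ᵥ* aeval A r) hab
  simpa [hA, mul_comm b q, ← vecMul_vecMul, hq] using this.symm

theorem stmt4 (n : ℕ) (hn : 0 < n) (hp : Nat.Prime (2 * n + 1)) :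
    StronglyIndependent (fun i : Fin n => MmatInt n ^ ((i : ℕ) + 1)) := by
  intro k hk
  set A : Matrix (Fin n) (Fin n) ℤ := of fun i => k ᵥ* MmatInt n ^ ((i : ℕ) + 1) with hA
  suffices hdet : A.det ≠ 0 by
    refine linearIndependent_rows_of_det_ne_zero
      (A := A.map (Int.castRingHom ℝ)) ?_
    rw [← RingHom.mapMatrix_apply, ← RingHom.map_det]
    simpa using hdet
  intro hdet
  obtain ⟨v, hv, hvA⟩ := exists_vecMul_eq_zero_iff.mpr hdet
  set q : ℤ[X] := ∑ i : Fin n, Polynomial.C (v i) * X ^ (i : ℕ) with hq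
  have hq_deg : q.degree < n := degree_sum_fin_lt v
  have hq_ne : q ≠ 0 := by
    intro h
    apply hv
    ext i
    have := congrArg (coeff · (i : ℕ)) h
    simpa [hq, finsetSum_coeff, coeff_C_mul, coeff_X_pow, Fin.val_inj] using this
  have hkq : k ᵥ* aeval (MmatInt n) (q * X) = 0 := by
    rw [← hvA, vecMul_eq_sum v A, hq, Finset.sum_mul, map_sum, vecMul_sum]
    refine Finset.sum_congr rfl fun i _ => ?_
    rw [mul_assoc, ← pow_succ, ← smul_eq_C_mul, map_smul, map_pow, aeval_X, vecMul_smul]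
    rfl
  obtain ⟨hm, hd⟩ := chebyshevV.monic_and_natDegree ℤ n
  have hf := chebyshevV.irreducible_comp hn hp
  set f := (chebyshevV ℤ n).comp (X - Polynomial.C 2) with hf_def
  have hfm : f.Monic := hm.comp_X_sub_C 2
  set φ : ℤ →+* ℚ := Int.castRingHom ℚ
  have hφ : Function.Injective φ := Int.cast_injective
  have hfQ : Irreducible (f.map φ) :=
    (hfm.irreducible_iff_irreducible_map_fraction_map (K := ℚ)).mp hf
  have hfd : (f.map φ).natDegree = n := by
    rw [hfm.natDegree_map, hf_def, natDegree_comp, natDegree_X_sub_C, hd, mul_one]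
  have haeval (r : ℤ[X]) : aeval (φ.mapMatrix (4 - MmatInt n)) (r.map φ) =
      φ.mapMatrix (aeval (4 - MmatInt n) r) := by
    simp only [aeval_def, eval₂_map, hom_eval₂]
    congr 1
    exact RingHom.ext_int _ _
  have hfA : aeval (φ.mapMatrix (4 - MmatInt n)) (f.map φ) = 0 := by
    rw [haeval, hf_def, aeval_comp]
    have h : aeval (4 - MmatInt n) (X - Polynomial.C 2 : ℤ[X]) = 2 - MmatInt n := by
      simp only [map_sub, aeval_X, map_ofNat]
      rw [sub_right_comm]
      norm_num
    rw [h, aeval_chebyshevV_MmatInt hn, map_zero]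
  have hkQ : (fun i => φ (k i)) ≠ 0 := by
    intro h
    exact hk (funext fun i => hφ (by simpa using congrFun h i))
  have hdvd : f.map φ ∣ ((q * X).comp (4 - X)).map φ := by
    refine dvd_of_vecMul_aeval_eq_zero hfQ hfA hkQ ?_
    have h : aeval (4 - MmatInt n) ((q * X).comp (4 - X)) = aeval (MmatInt n) (q * X) := by
      rw [aeval_comp]
      simp only [map_sub, aeval_X, map_ofNat, sub_sub_cancel]
    rw [haeval, h]
    ext j
    exact (RingHom.map_vecMul φ (aeval (MmatInt n) (q * X)) k j).symm.trans
      (by rw [hkq, Pi.zero_apply, Pi.zero_apply, map_zero])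
  rw [mul_comp, X_comp, Polynomial.map_mul] at hdvd
  have hX : (4 - X : ℤ[X]).natDegree = 1 := by
    rw [← natDegree_neg, neg_sub]
    exact natDegree_X_sub_C 4
  rcases hfQ.prime.dvd_or_dvd hdvd with h | h
  · rw [map_dvd_map φ hφ hfm] at h
    have hne : q.comp (4 - X) ≠ 0 := by
      rw [Ne, Polynomial.comp_eq_zero_iff, not_or]
      refine ⟨hq_ne, fun h => ?_⟩
      rw [h.2, natDegree_C] at hX
      lia
    refine hfm.not_dvd_of_natDegree_lt hne ?_ h
    rw [natDegree_comp, hX, mul_one, ← hfm.natDegree_map φ, hfd]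
    exact (natDegree_lt_iff_degree_lt hq_ne).mpr hq_deg
  · rw [map_dvd_map φ hφ hfm] at h
    have hirr : Irreducible (4 - X : ℤ[X]) := by
      rw [← neg_sub, Associated.irreducible_iff (Associated.refl _).neg_left]
      exact (prime_X_sub_C 4).irreducible
    have h₀ := eval_dvd (x := 4) (hf.dvd_symm hirr h)
    rw [hf_def, eval_comp] at h₀
    norm_num [chebyshevV.eval_two] at h₀
end
end

section
/- Let B ∈ GL(n,ℤ) be a matrix all of whose eigenvalues are distinct real numbers, and suppose that for every choice of n−1 of its (row) eigenvectors, the real vector space they span contains no nonzero element of ℤⁿ. Then B, B², …, Bⁿ are strongly independent over ℤⁿ∖{0}, i.e., for every nonzero row vector k ∈ ℤⁿ the row vectors kB, kB², …, kBⁿ are linearly independent over ℝ. -/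
open Matrix Polynomial

noncomputable section

theorem Matrix.vecMul_pow_eq_smul {R ι : Type*} [CommRing R] [Fintype ι] [DecidableEq ι]
    {A : Matrix ι ι R} {v : ι → R} {r : R} (h : v ᵥ* A = r • v) (m : ℕ) :
    v ᵥ* A ^ m = r ^ m • v := by
  induction m with
  | zero => simp
  | succ m ih => rw [pow_succ, ← vecMul_vecMul, ih, smul_vecMul, h, smul_smul, pow_succ]

theorem Matrix.linearIndependent_of_vecMul_eq_smul {K ι κ : Type*} [Field K] [Fintype ι]
    {A : Matrix ι ι K} {r : κ → K} (hr : Function.Injective r) {v : κ → ι → K}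
    (hv : ∀ i, v i ≠ 0) (h : ∀ i, v i ᵥ* A = r i • v i) : LinearIndependent K v :=
  Module.End.eigenvectors_linearIndependent' A.vecMulLinear r hr v fun i =>
    ⟨Module.End.mem_eigenspace_iff.2 (h i), hv i⟩

/-- If every coordinate of `v` in an eigenbasis of `A` is nonzero, and the eigenvalues are
distinct and nonzero, then `v A, v A², …, v Aⁿ` are linearly independent. -/
theorem Matrix.linearIndependent_vecMul_pow_succ {K : Type*} [Field K] {n : ℕ}
    {A : Matrix (Fin n) (Fin n) K} {r : Fin n → K} (hr : Function.Injective r)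
    (hr0 : ∀ i, r i ≠ 0) (b : Module.Basis (Fin n) K (Fin n → K))
    (hb : ∀ i, b i ᵥ* A = r i • b i) {v : Fin n → K} (hv : ∀ i, b.repr v i ≠ 0) :
    LinearIndependent K fun m : Fin n => v ᵥ* A ^ ((m : ℕ) + 1) := by
  have hpow (m : ℕ) : v ᵥ* A ^ m = ∑ i, (b.repr v i * r i ^ m) • b i := by
    conv_lhs => rw [← b.sum_repr v]
    simp_rw [sum_vecMul, smul_vecMul, vecMul_pow_eq_smul (hb _), smul_smul]
  have hrepr (m : ℕ) (i : Fin n) : b.repr (v ᵥ* A ^ m) i = b.repr v i * r i ^ m := by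
    rw [hpow, b.repr_sum_self]
  rw [Fintype.linearIndependent_iff]
  intro g hg
  refine congrFun (eq_zero_of_forall_index_sum_mul_pow_eq_zero hr fun i => ?_)
  have hi := congrArg (fun w => b.repr w i) hg
  simp only [map_sum, map_smul, Finsupp.coe_finsetSum, Finset.sum_apply, Finsupp.smul_apply,
    hrepr, smul_eq_mul, map_zero, Finsupp.zero_apply] at hi
  have : b.repr v i * r i * ∑ m : Fin n, g m * r i ^ (m : ℕ) = 0 := by
    rw [← hi, Finset.mul_sum]
    exact Finset.sum_congr rfl fun m _ => by ring
  exact (mul_eq_zero.1 this).resolve_left (mul_ne_zero (hv i) (hr0 i))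

theorem stmt5 {n : ℕ} (hn : 0 < n) (B : Matrix (Fin n) (Fin n) ℤ)
    (hB : IsUnit B.det)
    (lam : Fin n → ℝ) (hinj : Function.Injective lam)
    (hchar : (B.map (Int.cast : ℤ → ℝ)).charpoly = ∏ i, (X - C (lam i)))
    (beta : Fin n → (Fin n → ℝ)) (hbne : ∀ i, beta i ≠ 0)
    (heig : ∀ i, beta i ᵥ* B.map (Int.cast : ℤ → ℝ) = lam i • beta i)
    (hspan : ∀ i : Fin n, ∀ k : Fin n → ℤ, k ≠ 0 →
      (fun j => (k j : ℝ)) ∉ Submodule.span ℝ (beta '' {j | j ≠ i})) :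
    StronglyIndependent (fun i : Fin n => B ^ ((i : ℕ) + 1)) := by
  intro k hk
  set A := B.map (Int.cast : ℤ → ℝ)
  have : Nonempty (Fin n) := ⟨⟨0, hn⟩⟩
  have hdet : A.det ≠ 0 := by
    have h : A.det = (B.det : ℝ) := (Int.cast_det B).symm
    rw [h]
    exact_mod_cast hB.ne_zero
  have hlam (i : Fin n) : lam i ≠ 0 := fun h =>
    hbne i (eq_zero_of_vecMul_eq_zero hdet (by rw [heig, h, zero_smul]))
  let b := basisOfLinearIndependentOfCardEqFinrank
    (linearIndependent_of_vecMul_eq_smul hinj hbne heig) (by simp)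
  have hb : ⇑b = beta := coe_basisOfLinearIndependentOfCardEqFinrank _ _
  have hcoord (i : Fin n) : b.repr (fun j => (k j : ℝ)) i ≠ 0 := by
    intro h
    refine hspan i k hk ?_
    rw [← hb, b.mem_span_image]
    rintro j hj rfl
    exact Finsupp.mem_support_iff.1 hj h
  have hcast (m : ℕ) : (fun j => ((k ᵥ* B ^ m) j : ℝ)) = (fun j => (k j : ℝ)) ᵥ* A ^ m := by
    funext j
    have h := RingHom.map_vecMul (Int.castRingHom ℝ) (B ^ m) k j
    rw [Matrix.map_pow] at h
    exact h
  have hli := linearIndependent_vecMul_pow_succ hinj hlam b (fun i => by rw [hb, heig]) hcoord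
  simp_rw [← hcast] at hli
  exact hli
end
end

section
/- For every positive integer n, the determinant of the n×n tridiagonal matrix M_n(2) (diagonal entries (2, 2, …, 2, 1), entries 1 on the super- and subdiagonal, 0 elsewhere) equals 1. -/
open Matrix Polynomial

noncomputable section

/-- The upper bidiagonal matrix with entries `1` on the diagonal and superdiagonal. -/
def upperBidiagonalOnes (n : ℕ) : Matrix (Fin n) (Fin n) ℝ :=
  Matrix.of fun i j => if (i : ℕ) = j ∨ (i : ℕ) + 1 = j then 1 else 0

theorem det_upperBidiagonalOnes (n : ℕ) : (upperBidiagonalOnes n).det = 1 := by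
  rw [Matrix.det_of_isUpperTriangular]
  · simp [upperBidiagonalOnes]
  · intro i j hij
    have h : (j : ℕ) < i := hij
    simp only [upperBidiagonalOnes, Matrix.of_apply]
    rw [if_neg (by omega)]

theorem Mmat_two_eq_mul_transpose (n : ℕ) :
    Mmat n 2 = upperBidiagonalOnes n * (upperBidiagonalOnes n)ᵀ := by
  ext i j
  have hi := i.isLt
  have hj := j.isLt
  have row (k : Fin n) : upperBidiagonalOnes n i k =
      (if k = i then 1 else 0) + (if (i : ℕ) + 1 = k then 1 else 0) := by
    simp only [upperBidiagonalOnes, Matrix.of_apply, Fin.ext_iff]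
    split_ifs <;> first | omega | norm_num
  simp only [Matrix.mul_apply, Matrix.transpose_apply, row, add_mul, Finset.sum_add_distrib,
    ite_mul, one_mul, zero_mul, Finset.sum_ite_eq', Finset.mem_univ, if_true]
  by_cases h : (i : ℕ) + 1 < n
  · have succ_eq (k : Fin n) : (i : ℕ) + 1 = k ↔ k = ⟨i + 1, h⟩ := by
      rw [Fin.ext_iff, eq_comm]
    simp only [succ_eq, Finset.sum_ite_eq', Finset.mem_univ, if_true]
    simp only [Mmat, upperBidiagonalOnes, Matrix.of_apply]
    split_ifs <;> first | omega | norm_num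
  · have succ_ne (k : Fin n) : ¬ (i : ℕ) + 1 = k := by omega
    simp only [succ_ne, if_false, Finset.sum_const_zero]
    simp only [Mmat, upperBidiagonalOnes, Matrix.of_apply]
    split_ifs <;> first | omega | norm_num

theorem stmt6 (n : ℕ) (hn : 0 < n) : (Mmat n 2).det = 1 := by
  rw [Mmat_two_eq_mul_transpose, Matrix.det_mul, Matrix.det_transpose, det_upperBidiagonalOnes,
    one_mul]
end
end

section
/- Let a be a real number with a ≠ 2 and a ≠ −2, and let α = (a + √(a²−4))/2 and β = (a − √(a²−4))/2 (interpreted in ℂ when a² < 4) be the two roots of λ² − aλ + 1 = 0. Then for every positive integer n, det(M_n(a)) = (α^{n+1} + β^{n+1} + αⁿ + βⁿ)/(2 + a). -/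
open Matrix Polynomial

noncomputable section

/-- Expansion along the first row: the determinants satisfy a two-step recurrence. -/
theorem det_Mmat_add_two (a : ℝ) (n : ℕ) :
    (Mmat (n + 2) a).det = a * (Mmat (n + 1) a).det - (Mmat n a).det := by
  have h₁ : (Mmat (n + 2) a).submatrix Fin.succ Fin.succ = Mmat (n + 1) a := by
    ext i j
    simp only [Mmat, submatrix_apply, of_apply, Fin.val_succ]
    grind
  have h₂ : ((Mmat (n + 2) a).submatrix Fin.succ (Fin.succAbove 1)).submatrix
      Fin.succ Fin.succ = Mmat n a := by
    ext i j
    have hi := i.isLt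
    have hj : ((Fin.succAbove (1 : Fin (n + 2)) j.succ : Fin (n + 2)) : ℕ) = j + 2 := by
      rw [← Fin.succ_zero_eq_one, Fin.succ_succAbove_succ]
      simp
    simp only [Mmat, submatrix_apply, of_apply, Fin.val_succ, hj]
    grind
  have h₃ : ((Mmat (n + 2) a).submatrix Fin.succ (Fin.succAbove 1)).det = (Mmat n a).det := by
    rw [det_succ_column_zero, Fin.sum_univ_succ, Finset.sum_eq_zero, Fin.succAbove_zero, h₂]
    · simp [Mmat]
    · intro i _
      simp [Mmat]
  rw [det_succ_row_zero, Fin.sum_univ_succ, Fin.sum_univ_succ, Finset.sum_eq_zero,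
    Fin.succAbove_zero, h₁, Fin.succ_zero_eq_one, h₃]
  · simp [Mmat]
    ring
  · intro i _
    simp [Mmat]

/-- The closed form of the determinant, cleared of denominators, in terms of two numbers
with sum `a` and product `1`. -/
theorem det_Mmat_mul (a : ℝ) {α β : ℂ} (hs : α + β = a) (hp : α * β = 1) (n : ℕ) :
    ((Mmat n a).det : ℂ) * (2 + a) = α ^ (n + 1) + β ^ (n + 1) + α ^ n + β ^ n := by
  induction n using Nat.twoStepInduction with
  | zero =>
    simp only [det_fin_zero, Complex.ofReal_one, zero_add, pow_one, pow_zero]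
    linear_combination -hs
  | one =>
    simp only [det_unique, Mmat, of_apply]
    simp
    linear_combination (-(a : ℂ) - α - β - 1) * hs + 2 * hp
  | more n ih₀ ih₁ =>
    rw [det_Mmat_add_two]
    push_cast
    linear_combination (a : ℂ) * ih₁ - ih₀
      - (α ^ (n + 2) + β ^ (n + 2) + α ^ (n + 1) + β ^ (n + 1)) * hs
      + (α ^ (n + 1) + β ^ (n + 1) + α ^ n + β ^ n) * hp

theorem stmt10 (a : ℝ) (ha2 : a ≠ 2) (ha2' : a ≠ -2) (n : ℕ) (hn : 0 < n)
    (α β : ℂ)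
    (hα : α = ((a : ℂ) + ((a : ℂ) ^ 2 - 4) ^ ((1 : ℂ) / 2)) / 2)
    (hβ : β = ((a : ℂ) - ((a : ℂ) ^ 2 - 4) ^ ((1 : ℂ) / 2)) / 2) :
    ((Mmat n a).det : ℂ) = (α ^ (n + 1) + β ^ (n + 1) + α ^ n + β ^ n) / (2 + (a : ℂ)) := by
  have hsq : (((a : ℂ) ^ 2 - 4) ^ ((1 : ℂ) / 2)) ^ 2 = (a : ℂ) ^ 2 - 4 := by
    have h := Complex.cpow_nat_inv_pow ((a : ℂ) ^ 2 - 4) two_ne_zero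
    rwa [Nat.cast_ofNat, ← one_div] at h
  have hne : (2 + (a : ℂ)) ≠ 0 := by
    intro h
    apply ha2'
    have h' : (2 + a : ℝ) = 0 := by exact_mod_cast h
    linarith
  rw [eq_div_iff hne]
  apply det_Mmat_mul
  · rw [hα, hβ]
    ring
  · rw [hα, hβ]
    linear_combination -hsq / 4
end
end

section
/- For every positive integer n, the characteristic polynomial of the n×n matrix M_n(2) (diagonal entries (2, 2, …, 2, 1), entries 1 on the super- and subdiagonal, 0 elsewhere) has exactly n distinct real roots, namely 2 + 2cos(2kπ/(2n+1)) for k = 1, 2, …, n. -/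
open Matrix Polynomial

noncomputable section

/-- The vector `(sin θ, sin 2θ, …, sin nθ)` is an eigenvector of `Mmat n 2` as soon as
`sin ((n + 1) θ) = - sin (n θ)`. -/
theorem Mmat_two_mulVec_sin (n : ℕ) (θ : ℝ)
    (h : Real.sin ((n + 1) * θ) = -Real.sin (n * θ)) :
    Mmat n 2 *ᵥ (fun j : Fin n => Real.sin (((j : ℕ) + 1) * θ)) =
      (2 + 2 * Real.cos θ) • fun j : Fin n => Real.sin (((j : ℕ) + 1) * θ) := by
  have three_term (x : ℝ) :
      Real.sin ((x + 1 + 1) * θ) + Real.sin (x * θ) =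
        2 * Real.cos θ * Real.sin ((x + 1) * θ) := by
    rw [show (x + 1 + 1) * θ = (x + 1) * θ + θ by ring,
      show x * θ = (x + 1) * θ - θ by ring, Real.sin_add, Real.sin_sub]
    ring
  ext ⟨i, hi⟩
  have key : (Mmat n 2 *ᵥ (fun j : Fin n => Real.sin (((j : ℕ) + 1) * θ))) ⟨i, hi⟩ =
      ∑ j ∈ Finset.range n,
        ((if j = i then (if i = n - 1 then 1 else 2) * Real.sin ((i + 1) * θ) else 0)
          + (if j = i + 1 then Real.sin ((i + 1 + 1) * θ) else 0)
          + (if j + 1 = i then Real.sin (i * θ) else 0)) := by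
    rw [Finset.sum_range, Matrix.mulVec, dotProduct]
    refine Finset.sum_congr rfl fun j _ => ?_
    obtain ⟨j, hj⟩ := j
    simp only [Mmat, Matrix.of_apply]
    rcases eq_or_ne j i with rfl | hji
    · norm_num
    rcases eq_or_ne j (i + 1) with rfl | hji'
    · have : ¬ i + 1 + 1 = i := by omega
      simp [this]
    rcases eq_or_ne (j + 1) i with rfl | hji''
    · simp [hji']
    · simp [hji, hji', hji'', hji.symm, hji'.symm]
  have lower : ∑ j ∈ Finset.range n, (if j + 1 = i then Real.sin (i * θ) else 0) =
      Real.sin (i * θ) := by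
    cases i with
    | zero => simp
    | succ m =>
      have : m < n := by omega
      simp [this]
  rw [key, Finset.sum_add_distrib, Finset.sum_add_distrib, lower]
  simp only [Finset.sum_ite_eq', Finset.mem_range, hi, if_true, Pi.smul_apply, smul_eq_mul]
  have := three_term i
  by_cases hlast : i = n - 1
  · have hn : (n : ℝ) = i + 1 := by
      have : n = i + 1 := by omega
      exact_mod_cast this
    rw [hn] at h
    rw [if_pos hlast, if_neg (by omega)]
    linarith
  · rw [if_neg hlast, if_pos (by omega)]
    linarith

/-- The angles `2kπ/(2n+1)`, `1 ≤ k ≤ n`, lie strictly between `0` and `π`. -/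
theorem two_mul_pi_div_mem_Ioo {n k : ℕ} (hk : k ∈ Set.Icc 1 n) :
    2 * k * Real.pi / (2 * n + 1) ∈ Set.Ioo 0 Real.pi := by
  have h1 : (1 : ℝ) ≤ k := by exact_mod_cast hk.1
  have h2 : (k : ℝ) ≤ n := by exact_mod_cast hk.2
  have hpi := Real.pi_pos
  refine ⟨by positivity, ?_⟩
  rw [div_lt_iff₀ (by positivity)]
  nlinarith

theorem injOn_two_add_two_mul_cos (n : ℕ) :
    Set.InjOn (fun k : ℕ => 2 + 2 * Real.cos (2 * k * Real.pi / (2 * n + 1)))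
      (Set.Icc 1 n) := by
  intro k hk l hl hkl
  have hcos : Real.cos (2 * k * Real.pi / (2 * n + 1)) =
      Real.cos (2 * l * Real.pi / (2 * n + 1)) := by
    simpa using hkl
  have := Real.injOn_cos (Set.Ioo_subset_Icc_self (two_mul_pi_div_mem_Ioo hk))
    (Set.Ioo_subset_Icc_self (two_mul_pi_div_mem_Ioo hl)) hcos
  have hpi := Real.pi_ne_zero
  have hn : (2 * n + 1 : ℝ) ≠ 0 := by positivity
  field_simp at this
  exact_mod_cast this

theorem isRoot_charpoly_Mmat_two {n k : ℕ} (hk : k ∈ Set.Icc 1 n) :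
    (Mmat n 2).charpoly.IsRoot (2 + 2 * Real.cos (2 * k * Real.pi / (2 * n + 1))) := by
  set θ := 2 * k * Real.pi / (2 * n + 1) with hθ
  have hn : 0 < n := lt_of_lt_of_le hk.1 hk.2
  have hmem : θ ∈ Set.Ioo 0 Real.pi := two_mul_pi_div_mem_Ioo hk
  have hsin : Real.sin ((n + 1) * θ) = -Real.sin (n * θ) := by
    have : (n + 1) * θ = k * (2 * Real.pi) - n * θ := by
      rw [hθ]
      field_simp
      ring
    rw [this, Real.sin_nat_mul_two_pi_sub]
  rw [← Matrix.charpoly_toLin', ← Module.End.hasEigenvalue_iff_isRoot_charpoly]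
  refine Module.End.hasEigenvalue_of_hasEigenvector
    (x := fun j : Fin n => Real.sin (((j : ℕ) + 1) * θ)) ⟨?_, fun h0 => ?_⟩
  · rw [Module.End.mem_eigenspace_iff, Matrix.toLin'_apply]
    exact Mmat_two_mulVec_sin n θ hsin
  · have := congrFun h0 ⟨0, hn⟩
    simp only [Nat.cast_zero, zero_add, one_mul, Pi.zero_apply] at this
    exact (Real.sin_pos_of_mem_Ioo hmem).ne' this

theorem stmt12 (n : ℕ) (hn : 0 < n) :
    (Mmat n 2).charpoly.roots =
        (Finset.Icc 1 n).val.map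
          (fun k : ℕ => 2 + 2 * Real.cos (2 * k * Real.pi / (2 * n + 1)))
      ∧ Set.InjOn (fun k : ℕ => 2 + 2 * Real.cos (2 * k * Real.pi / (2 * n + 1)))
          (Set.Icc 1 n) := by
  refine ⟨?_, injOn_two_add_two_mul_cos n⟩
  have hnodup : ((Finset.Icc 1 n).val.map
      (fun k : ℕ => 2 + 2 * Real.cos (2 * k * Real.pi / (2 * n + 1)))).Nodup :=
    Multiset.Nodup.map_on
      (fun k hk l hl h => injOn_two_add_two_mul_cos n
        (by simpa using hk) (by simpa using hl) h)
      (Finset.Icc 1 n).nodup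
  refine (Multiset.eq_of_le_of_card_le ((Multiset.le_iff_subset hnodup).2 ?_) ?_).symm
  · intro x hx
    obtain ⟨k, hk, rfl⟩ := Multiset.mem_map.1 hx
    exact (Polynomial.mem_roots (Mmat n 2).charpoly_monic.ne_zero).2
      (isRoot_charpoly_Mmat_two (by simpa using hk))
  · refine (Polynomial.card_roots' _).trans ?_
    simp [Matrix.charpoly_natDegree_eq_dim]
end
end

section
/- Let n be a positive integer with n ≢ 1 (mod 3). Then every eigenvalue of the n×n matrix M_n(2) (diagonal entries (2, 2, …, 2, 1), entries 1 on the super- and subdiagonal, 0 elsewhere) is irrational; equivalently, every real root of its characteristic polynomial is irrational. -/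
open Matrix Polynomial

noncomputable section

/-- The sequence `1, c, c² - 1, …` with `u (k + 2) = c * u (k + 1) - u k`
(Chebyshev polynomials of the second kind at `c / 2`). -/
def chebSeq (c : ℤ) : ℕ → ℤ
  | 0 => 1
  | 1 => c
  | k + 2 => c * chebSeq c (k + 1) - chebSeq c k

lemma chebSeq_abs_lt_succ {c : ℤ} (hc : 2 ≤ |c|) (k : ℕ) :
    |chebSeq c k| < |chebSeq c (k + 1)| := by
  induction k with
  | zero => simp only [chebSeq, abs_one]; omega
  | succ k ih =>
    have h1 : |c * chebSeq c (k + 1)| ≤ |chebSeq c (k + 2)| + |chebSeq c k| := by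
      have h : c * chebSeq c (k + 1) = chebSeq c (k + 2) + chebSeq c k := by
        simp [chebSeq]
      rw [h]
      exact abs_add_le _ _
    rw [abs_mul] at h1
    have h2 := mul_le_mul_of_nonneg_right hc (abs_nonneg (chebSeq c (k + 1)))
    change |chebSeq c (k + 1)| < |chebSeq c (k + 2)|
    linarith

lemma chebSeq_zero_succ_ne_neg (k : ℕ) :
    chebSeq 0 (k + 1) ≠ -chebSeq 0 k := by
  have h : chebSeq 0 k ^ 2 + chebSeq 0 (k + 1) ^ 2 = 1 := by
    induction k with
    | zero => simp [chebSeq]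
    | succ k ih => simp only [chebSeq] at ih ⊢; linarith
  intro h'
  rw [h', neg_sq] at h
  generalize chebSeq 0 k ^ 2 = a at h
  omega

lemma chebSeq_neg_one (k : ℕ) :
    chebSeq (-1) (3 * k) = 1 ∧ chebSeq (-1) (3 * k + 1) = -1 := by
  induction k with
  | zero => simp [chebSeq]
  | succ k ih =>
    rw [show 3 * (k + 1) = 3 * k + 3 by ring]
    simp only [chebSeq, ih.1, ih.2]
    norm_num

lemma chebSeq_one (k : ℕ) :
    chebSeq 1 (3 * k) = (-1) ^ k ∧ chebSeq 1 (3 * k + 1) = (-1) ^ k := by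
  induction k with
  | zero => simp [chebSeq]
  | succ k ih =>
    rw [show 3 * (k + 1) = 3 * k + 3 by ring]
    simp only [chebSeq, ih.1, ih.2, pow_succ]
    constructor <;> ring

lemma chebSeq_succ_ne_neg (c : ℤ) {m : ℕ} (hm : m % 3 ≠ 0) :
    chebSeq c (m + 1) ≠ -chebSeq c m := by
  by_cases hc : 2 ≤ |c|
  · intro h
    have := chebSeq_abs_lt_succ hc m
    rw [h, abs_neg] at this
    exact lt_irrefl _ this
  have hc' : c = -1 ∨ c = 0 ∨ c = 1 := by
    rw [not_le, abs_lt] at hc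
    omega
  have hm' : m = 3 * (m / 3) + 1 ∨ m = 3 * (m / 3) + 2 := by omega
  rcases hc' with rfl | rfl | rfl
  · obtain ⟨h0, h1⟩ := chebSeq_neg_one (m / 3)
    rcases hm' with h | h <;> rw [h] <;> simp [chebSeq, h0, h1]
  · exact chebSeq_zero_succ_ne_neg m
  · obtain ⟨h0, h1⟩ := chebSeq_one (m / 3)
    rcases hm' with h | h <;> rw [h] <;> simp [chebSeq, h0, h1]

lemma Mmat_two_eq_map (n : ℕ) : Mmat n 2 = (MmatInt n).map (Int.castRingHom ℝ) := by
  ext i j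
  simp only [Mmat, MmatInt, Matrix.of_apply, Matrix.map_apply]
  split_ifs <;> norm_num

lemma exists_int_of_isRoot_charpoly_map {n : ℕ} (A : Matrix (Fin n) (Fin n) ℤ) {q : ℚ}
    (h : (A.map (Int.castRingHom ℝ)).charpoly.IsRoot (q : ℝ)) : ∃ z : ℤ, (z : ℚ) = q := by
  rw [Matrix.charpoly_map] at h
  have h1 : IsIntegral ℤ (q : ℝ) :=
    ⟨A.charpoly, A.charpoly_monic, by
      rwa [Polynomial.IsRoot.def, Polynomial.eval_map] at h⟩
  have h2 : IsIntegral ℤ q :=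
    (isIntegral_algebraMap_iff (B := ℝ) (algebraMap ℚ ℝ).injective).1 (by simpa using h1)
  obtain ⟨z, hz⟩ := IsIntegrallyClosed.isIntegral_iff.1 h2
  exact ⟨z, by simpa using hz⟩

/-- The rows of `M_n(2) v = x v`, for a sequence `w` extending `v` by `w n = -w (n - 1)`. -/
lemma Mmat_two_mulVec_apply {n : ℕ} (w : ℕ → ℝ) (hw : w n = -w (n - 1)) (i : Fin n) :
    (Mmat n 2 *ᵥ fun j => w j) i =
      2 * w i + w (i + 1) + if (i : ℕ) = 0 then 0 else w (i - 1) := by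
  obtain ⟨i, hi⟩ := i
  simp only [Matrix.mulVec, dotProduct, Mmat, Matrix.of_apply]
  rw [Fin.sum_univ_eq_sum_range (fun j => (if i = j then (if i = n - 1 then (2 : ℝ) - 1 else 2)
    else if i + 1 = j ∨ j + 1 = i then 1 else 0) * w j) n]
  have key : ∀ j ∈ Finset.range n,
      (if i = j then (if i = n - 1 then (2 : ℝ) - 1 else 2)
        else if i + 1 = j ∨ j + 1 = i then 1 else 0) * w j =
      (if i = j then (if i = n - 1 then (2 : ℝ) - 1 else 2) * w j else 0) +
      (if i + 1 = j then w j else 0) +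
      (if i - 1 = j then (if i = 0 then 0 else w j) else 0) := by
    intro j _
    split_ifs <;> first | omega | simp
  rw [Finset.sum_congr rfl key, Finset.sum_add_distrib, Finset.sum_add_distrib,
    Finset.sum_ite_eq, Finset.sum_ite_eq, Finset.sum_ite_eq]
  have hi' : i - 1 < n := by omega
  simp only [Finset.mem_range, hi, hi', if_true]
  by_cases h : i = n - 1
  · have h' : i + 1 = n := by omega
    have : w (i + 1) = -w i := by rw [h', hw, h]
    rw [if_pos h, if_neg (show ¬i + 1 < n by omega), this]
    ring
  · rw [if_neg h, if_pos (show i + 1 < n by omega)]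

lemma chebSeq_eq_neg_of_isRoot_charpoly {n : ℕ} (hn : 0 < n) {z : ℤ}
    (h : (Mmat n 2).charpoly.IsRoot (z : ℝ)) :
    chebSeq (z - 2) n = -chebSeq (z - 2) (n - 1) := by
  rw [Polynomial.IsRoot.def, Matrix.eval_charpoly] at h
  obtain ⟨v, hv0, hv⟩ := Matrix.exists_mulVec_eq_zero_iff.2 h
  set w : ℕ → ℝ := fun i =>
    if hi : i < n then v ⟨i, hi⟩ else -v ⟨n - 1, by omega⟩ with hw_def
  have hvw : v = fun j : Fin n => w j := by
    funext j
    simp [hw_def]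
  have hwn : w n = -w (n - 1) := by
    simp [hw_def, hn]
  have row : ∀ i < n, 2 * w i + w (i + 1) + (if i = 0 then 0 else w (i - 1)) = z * w i := by
    intro i hi
    have := congrFun hv ⟨i, hi⟩
    rw [Matrix.sub_mulVec, Pi.sub_apply, hvw, Mmat_two_mulVec_apply w hwn] at this
    simp at this
    linarith
  have hw : ∀ i, (i ≤ n → w i = w 0 * chebSeq (z - 2) i) ∧
      (i + 1 ≤ n → w (i + 1) = w 0 * chebSeq (z - 2) (i + 1)) := by
    intro i
    induction i with
    | zero =>
      refine ⟨fun _ => by simp [chebSeq], fun hi => ?_⟩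
      have := row 0 hn
      simp only [if_true] at this
      simp only [chebSeq, zero_add] at this ⊢
      push_cast
      linarith
    | succ i ih =>
      refine ⟨ih.2, fun hi => ?_⟩
      have := row (i + 1) (by omega)
      rw [if_neg (by omega), Nat.add_sub_cancel, ih.1 (by omega), ih.2 (by omega)] at this
      simp only [chebSeq] at this ⊢
      push_cast
      linarith
  have hw0 : w 0 ≠ 0 := by
    intro h0
    apply hv0
    rw [hvw]
    funext j
    rw [(hw j).1 j.2.le, h0, zero_mul, Pi.zero_apply]
  rw [(hw n).1 le_rfl, (hw (n - 1)).1 (by omega)] at hwn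
  rw [← mul_neg] at hwn
  exact_mod_cast mul_left_cancel₀ hw0 hwn

theorem stmt13 (n : ℕ) (hn : 0 < n) (h3 : n % 3 ≠ 1) :
    ∀ x : ℝ, (Mmat n 2).charpoly.IsRoot x → Irrational x := by
  rintro x hx ⟨q, rfl⟩
  obtain ⟨z, rfl⟩ := exists_int_of_isRoot_charpoly_map (MmatInt n) (Mmat_two_eq_map n ▸ hx)
  rw [Rat.cast_intCast] at hx
  obtain ⟨m, rfl⟩ : ∃ m, n = m + 1 := ⟨n - 1, by omega⟩
  exact chebSeq_succ_ne_neg (z - 2) (m := m) (by omega) (chebSeq_eq_neg_of_isRoot_charpoly hn hx)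
end
end

section
/- Let B₁, …, Bₙ ∈ GL(n,ℤ) be strongly independent over ℤⁿ∖{0} and let μ be a Borel probability measure on 𝕋ⁿ. If there exists a nonzero row vector k ∈ ℤⁿ such that μ̂(kBᵢ) = 1 for every i = 1, …, n, then μ is an atomic measure on 𝕋ⁿ (in fact its support is a finite set). -/
open MeasureTheory Filter Matrix

noncomputable section

/-- A measurable function of modulus one whose mean is `1` equals `1` almost everywhere. -/
theorem ae_eq_one_of_integral_eq_one {X : Type*} [MeasurableSpace X] {μ : Measure X}
    [IsProbabilityMeasure μ] {f : X → ℂ} (hf : AEStronglyMeasurable f μ)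
    (hnorm : ∀ x, ‖f x‖ = 1) (h : ∫ x, f x ∂μ = 1) : ∀ᵐ x ∂μ, f x = 1 := by
  have hint : Integrable f μ := Integrable.of_bound hf 1 (Eventually.of_forall fun x => (hnorm x).le)
  have hint_re : Integrable (fun x => (f x).re) μ := hint.re
  have hre : ∫ x, (f x).re ∂μ = 1 := by
    have := integral_re hint
    simpa [h] using this
  have hle : ∀ x, (f x).re ≤ 1 := fun x => (Complex.re_le_norm _).trans_eq (hnorm x)
  have hzero : ∫ x, (1 - (f x).re) ∂μ = 0 := by
    rw [integral_sub (integrable_const _) hint_re, hre]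
    simp
  have hae := (integral_eq_zero_iff_of_nonneg (fun x => sub_nonneg.2 (hle x))
    ((integrable_const _).sub hint_re)).1 hzero
  filter_upwards [hae] with x hx
  have hx1 : (f x).re = 1 := (sub_eq_zero.1 hx).symm
  have hsq : Complex.normSq (f x) = 1 := by rw [Complex.normSq_eq_norm_sq, hnorm, one_pow]
  rw [Complex.normSq_apply, hx1] at hsq
  have him : (f x).im = 0 := by nlinarith
  exact Complex.ext (by simpa using hx1) (by simpa using him)

/-- A character of the torus is the circle-valued exponential of an integer linear form. -/
theorem prod_fourier_eq_toCircle {n : ℕ} (k : Fin n → ℤ) (x : Torus n) :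
    ∏ i, fourier (k i) (x i) = ((∑ i, k i • x i).toCircle : ℂ) := by
  have hsum : ∀ s : Finset (Fin n), ∏ i ∈ s, fourier (k i) (x i) =
      ((∑ i ∈ s, k i • x i).toCircle : ℂ) := by
    intro s
    induction s using Finset.cons_induction with
    | empty => simp
    | cons a s ha ih =>
      rw [Finset.prod_cons, Finset.sum_cons, AddCircle.toCircle_add, Circle.coe_mul, ih,
        fourier_apply]
  exact hsum _

/-- If `μ̂(k) = 1`, then `μ` lives on the kernel of the character with frequency `k`. -/
theorem ae_sum_zsmul_eq_zero_of_fourierCoef_eq_one {n : ℕ} {μ : Measure (Torus n)}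
    [IsProbabilityMeasure μ] {k : Fin n → ℤ} (h : fourierCoef μ k = 1) :
    ∀ᵐ x ∂μ, ∑ i, k i • x i = 0 := by
  simp only [fourierCoef, prod_fourier_eq_toCircle] at h
  have hcont : Continuous fun x : Torus n => ((∑ i, k i • x i).toCircle : ℂ) := by
    refine continuous_subtype_val.comp (AddCircle.continuous_toCircle.comp ?_)
    exact continuous_finsetSum _ fun i _ => (continuous_apply i).zsmul (k i)
  filter_upwards [ae_eq_one_of_integral_eq_one hcont.aestronglyMeasurable
    (fun x => Circle.norm_coe _) h] with x hx
  exact AddCircle.injective_toCircle one_ne_zero ((Circle.ext hx).trans AddCircle.toCircle_zero.symm)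

/-- The kernel of the endomorphism of the torus given by a nonsingular matrix is finite. -/
theorem finite_setOf_mulMap_eq_zero {n : ℕ} {A : Matrix (Fin n) (Fin n) ℤ} (hA : A.det ≠ 0) :
    {x : Torus n | mulMap A x = 0}.Finite := by
  refine (Set.Finite.pi' fun _ : Fin n =>
    AddCircle.finite_torsion_of_isSMulRegular_int (1 : ℝ) A.det
      (.of_right_eq_zero_of_smul fun _ => by simp [hA])).subset fun x hx i => ?_
  have hx' : ∀ j, ∑ l, A j l • x l = 0 := fun j => congrFun hx j
  have hadj : ∑ l, (A.adjugate * A) i l • x l = 0 := by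
    simp only [Matrix.mul_apply, Finset.sum_smul, mul_smul]
    rw [Finset.sum_comm]
    simp only [← Finset.smul_sum, hx', smul_zero, Finset.sum_const_zero]
  simpa [Matrix.adjugate_mul, Matrix.smul_apply, Matrix.one_apply, ite_smul] using hadj

/-- The support of a measure is contained in every closed set of full measure. -/
theorem measSupport_subset_of_ae_mem {X : Type*} [TopologicalSpace X] [MeasurableSpace X]
    {μ : Measure X} {S : Set X} (hS : IsClosed S) (h : ∀ᵐ x ∂μ, x ∈ S) : measSupport μ ⊆ S := by
  intro x hx
  by_contra hxS
  exact (hx Sᶜ hS.isOpen_compl hxS).ne' (mem_ae_iff.1 h)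

/-- A nonzero measure concentrated on a countable set has an atom. -/
theorem exists_measure_singleton_pos {X : Type*} [MeasurableSpace X] {μ : Measure X} [NeZero μ]
    {S : Set X} (hS : S.Countable) (h : ∀ᵐ x ∂μ, x ∈ S) : ∃ x, 0 < μ {x} := by
  by_contra! hzero
  have hnull : μ S = 0 := by
    rw [← Set.biUnion_of_singleton S]
    exact (measure_biUnion_null_iff hS).2 fun x _ => le_antisymm (hzero x) zero_le
  have huniv : μ Set.univ = 0 := by
    rw [← Set.union_compl_self S]
    exact measure_union_null hnull (mem_ae_iff.1 h)
  exact NeZero.ne μ (Measure.measure_univ_eq_zero.1 huniv)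

theorem stmt17 {n : ℕ} (B : Fin n → Matrix (Fin n) (Fin n) ℤ)
    (hBGL : ∀ i, IsUnit (B i).det)
    (hSI : StronglyIndependent B)
    (μ : Measure (Torus n)) [IsProbabilityMeasure μ]
    (k : Fin n → ℤ) (hk : k ≠ 0)
    (h : ∀ i : Fin n, fourierCoef μ (k ᵥ* B i) = 1) :
    (∃ x : Torus n, 0 < μ {x}) ∧ (measSupport μ).Finite := by
  let A : Matrix (Fin n) (Fin n) ℤ := Matrix.of fun i => k ᵥ* B i
  have hdet : A.det ≠ 0 := by
    have hli : LinearIndependent ℝ (A.map (Int.castRingHom ℝ)).row := hSI k hk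
    have hunit := (Matrix.isUnit_iff_isUnit_det _).1 (linearIndependent_rows_iff_isUnit.1 hli)
    intro hzero
    refine hunit.ne_zero ?_
    rw [← RingHom.mapMatrix_apply, ← RingHom.map_det, hzero, map_zero]
  have hfin := finite_setOf_mulMap_eq_zero hdet
  have hae : ∀ᵐ x ∂μ, x ∈ {x : Torus n | mulMap A x = 0} := by
    filter_upwards [ae_all_iff.2 fun i => ae_sum_zsmul_eq_zero_of_fourierCoef_eq_one (h i)]
      with x hx
    exact funext hx
  exact ⟨exists_measure_singleton_pos hfin.countable hae,
    hfin.subset (measSupport_subset_of_ae_mem hfin.isClosed hae)⟩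
end
end
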